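/- arXiv:2104.14845 — 4 statements merged into one kernel-verified Lean document; each statement's English description precedes it below -/
import Mathlib

section
/- Let P_0, P_1, …, P_n ∈ ℂ[x_0,…,x_n] be a regular sequence of homogeneous polynomials of degrees d_0, …, d_n ≥ 1, let I = (P_0,…,P_n), and set σ = (Σ_{i=0}^n d_i) − (n+1). Then for every integer j with 0 ≤ j ≤ σ, the ℂ-bilinear map (S/I)_j × (S/I)_{σ−j} → (S/I)_σ induced by multiplication is a perfect pairing; that is, the induced ℂ-linear map (S/I)_j → Hom_ℂ((S/I)_{σ−j}, (S/I)_σ) is bijective. -/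
/-- The polynomial ring `S = ℂ[x_0, …, x_n]` (in `n+1` variables). -/
abbrev PolyS (n : ℕ) : Type := MvPolynomial (Fin (n + 1)) ℂ

/-- The graded piece `S_j` of homogeneous polynomials of degree `j` (together with `0`). -/
noncomputable abbrev polyGrade (n j : ℕ) : Submodule ℂ (PolyS n) :=
  MvPolynomial.homogeneousSubmodule (Fin (n + 1)) ℂ j

/-- The graded piece `(S/I)_j = S_j / (I ∩ S_j)` of the quotient by an ideal `I`. -/
noncomputable abbrev quotPiece (n : ℕ) (I : Ideal (PolyS n)) (j : ℕ) : Type :=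
  ↥(polyGrade n j) ⧸ (Submodule.comap (polyGrade n j).subtype (I.restrictScalars ℂ))

lemma mul_mem_polyGrade {n j m : ℕ} (f : polyGrade n j) (g : polyGrade n m) :
    (f : PolyS n) * (g : PolyS n) ∈ polyGrade n (j + m) :=
  (MvPolynomial.mem_homogeneousSubmodule _ _).2
    (((MvPolynomial.mem_homogeneousSubmodule _ _).1 f.2).mul
      ((MvPolynomial.mem_homogeneousSubmodule _ _).1 g.2))

/-- `B` is (the bilinear map induced by) the multiplication pairing
`(S/I)_j × (S/I)_m → (S/I)_σ`, where `j + m = σ`. -/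
def IsMulPairing (n : ℕ) (I : Ideal (PolyS n)) (j m σ : ℕ) (hjm : j + m = σ)
    (B : quotPiece n I j →ₗ[ℂ] quotPiece n I m →ₗ[ℂ] quotPiece n I σ) : Prop :=
  ∀ (f : polyGrade n j) (g : polyGrade n m),
    B (Submodule.Quotient.mk f) (Submodule.Quotient.mk g) =
      Submodule.Quotient.mk ⟨(f : PolyS n) * (g : PolyS n), hjm ▸ mul_mem_polyGrade f g⟩


open MvPolynomial

namespace Macaulay

variable {n : ℕ}

/-- Ideal closed under homogeneous components. -/
def HomI (J : Ideal (PolyS n)) : Prop :=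
  ∀ f ∈ J, ∀ k, homogeneousComponent k f ∈ J

/-- `a` is a nonzerodivisor modulo `J`. -/
def Nzd (J : Ideal (PolyS n)) (a : PolyS n) : Prop := ∀ f, a * f ∈ J → f ∈ J

lemma mem_sup_sp {J : Ideal (PolyS n)} {a f : PolyS n} :
    f ∈ J ⊔ Ideal.span {a} ↔ ∃ g, f - a * g ∈ J := by
  constructor
  · intro h
    obtain ⟨j, hj, z, hz, rfl⟩ := Submodule.mem_sup.1 h
    obtain ⟨g, rfl⟩ := Ideal.mem_span_singleton'.1 hz
    exact ⟨g, by simpa [mul_comm] using hj⟩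
  · rintro ⟨g, hg⟩
    have := Submodule.add_mem_sup hg (Ideal.mul_mem_right g (Ideal.span {a})
      (Ideal.subset_span (Set.mem_singleton a)))
    simpa using this

lemma hc_mul {a g : PolyS n} {p : ℕ} (ha : a.IsHomogeneous p) (m : ℕ) :
    homogeneousComponent (m + p) (a * g) = a * homogeneousComponent m g := by
  conv_lhs => rw [← sum_homogeneousComponent g, Finset.mul_sum, map_sum]
  have h : ∀ i, homogeneousComponent (m + p) (a * homogeneousComponent i g)
      = if i = m then a * homogeneousComponent m g else 0 := by
    intro i
    rw [homogeneousComponent_of_mem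
      (ha.mul (homogeneousComponent_isHomogeneous i g))]
    split_ifs with h1 h2 h2
    · rw [h2]
    · omega
    · omega
    · rfl
  simp only [h, Finset.sum_ite_eq', Finset.mem_range]
  split_ifs with h1
  · rfl
  · rw [homogeneousComponent_eq_zero, mul_zero]; omega

lemma hc_mul_lt {a g : PolyS n} {p : ℕ} (ha : a.IsHomogeneous p) {k : ℕ} (hk : k < p) :
    homogeneousComponent k (a * g) = 0 := by
  conv_lhs => rw [← sum_homogeneousComponent g, Finset.mul_sum, map_sum]
  refine Finset.sum_eq_zero fun i _ => ?_
  rw [homogeneousComponent_of_mem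
      (ha.mul (homogeneousComponent_isHomogeneous i g)), if_neg (by omega)]

lemma hc_self {f : PolyS n} {k : ℕ} (hf : f.IsHomogeneous k) :
    homogeneousComponent k f = f := by
  rw [homogeneousComponent_of_mem hf, if_pos rfl]

lemma HomI.sup {J : Ideal (PolyS n)} (hJ : HomI J) {a : PolyS n} {p : ℕ}
    (ha : a.IsHomogeneous p) : HomI (J ⊔ Ideal.span {a}) := by
  intro f hf k
  obtain ⟨g, hg⟩ := mem_sup_sp.1 hf
  have := hJ _ hg k
  rw [map_sub] at this
  rcases lt_or_ge k p with h | h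
  · rw [hc_mul_lt ha h, sub_zero] at this
    exact Submodule.mem_sup_left this
  · obtain ⟨m, rfl⟩ := Nat.exists_eq_add_of_le' h
    rw [hc_mul ha] at this
    exact mem_sup_sp.2 ⟨_, this⟩

lemma homI_bot : HomI (⊥ : Ideal (PolyS n)) := by
  intro f hf k
  rw [Ideal.mem_bot] at hf ⊢
  simp [hf]

/-- Homogeneous membership in `J + (a)`. -/
lemma mem_sup_hom {J : Ideal (PolyS n)} (hJ : HomI J) {a f : PolyS n} {p k : ℕ}
    (ha : a.IsHomogeneous p) (hf : f.IsHomogeneous k) (h : f ∈ J ⊔ Ideal.span {a}) :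
    f ∈ J ∨ ∃ m g, m + p = k ∧ g.IsHomogeneous m ∧ f - a * g ∈ J := by
  obtain ⟨g, hg⟩ := mem_sup_sp.1 h
  have := hJ _ hg k
  rw [map_sub, hc_self hf] at this
  rcases lt_or_ge k p with h | h
  · rw [hc_mul_lt ha h, sub_zero] at this
    exact Or.inl this
  · obtain ⟨m, rfl⟩ := Nat.exists_eq_add_of_le' h
    rw [hc_mul ha] at this
    exact Or.inr ⟨m, _, rfl, homogeneousComponent_isHomogeneous m g, this⟩

/-- Recursive regular-sequence predicate. -/
def RegOn : Ideal (PolyS n) → List (PolyS n × ℕ) → Prop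
  | _, [] => True
  | J, a :: L => Nzd J a.1 ∧ RegOn (J ⊔ Ideal.span {a.1}) L

/-- The ideal `J + (L)`. -/
noncomputable def idl : Ideal (PolyS n) → List (PolyS n × ℕ) → Ideal (PolyS n)
  | J, [] => J
  | J, a :: L => idl (J ⊔ Ideal.span {a.1}) L

/-- all entries homogeneous of the recorded positive degree -/
def Good (L : List (PolyS n × ℕ)) : Prop := ∀ a ∈ L, a.1.IsHomogeneous a.2 ∧ 1 ≤ a.2

lemma nzd_swap1 {J : Ideal (PolyS n)} (hJ : HomI J) {a b : PolyS n} {p q : ℕ}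
    (ha : a.IsHomogeneous p) (hb : b.IsHomogeneous q) (hp : 1 ≤ p)
    (h1 : Nzd J a) (h2 : Nzd (J ⊔ Ideal.span {a}) b) : Nzd J b := by
  have key : ∀ k, ∀ f : PolyS n, f.IsHomogeneous k → b * f ∈ J → f ∈ J := by
    intro k
    induction k using Nat.strong_induction_on with
    | _ k ih =>
      intro f hf hbf
      rcases mem_sup_hom hJ ha hf (h2 _ (Submodule.mem_sup_left hbf)) with h | ⟨m, g, hm, hg, h⟩
      · exact h
      · have : b * g ∈ J := by
          apply h1
          have := J.sub_mem hbf (J.mul_mem_left b h)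
          convert this using 1; ring
        have := ih m (by omega) g hg this
        have := J.add_mem h (J.mul_mem_left a this)
        simpa using this
  intro f hf
  rw [← sum_homogeneousComponent f]
  refine J.sum_mem fun i _ => key i _ (homogeneousComponent_isHomogeneous i f) ?_
  rw [← hc_mul hb]
  exact hJ _ hf _

lemma nzd_swap2 {J : Ideal (PolyS n)} {a b : PolyS n}
    (h1 : Nzd J a) (h2 : Nzd (J ⊔ Ideal.span {a}) b) : Nzd (J ⊔ Ideal.span {b}) a := by
  intro f hf
  obtain ⟨g, hg⟩ := mem_sup_sp.1 hf
  have : g ∈ J ⊔ Ideal.span {a} := by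
    apply h2
    refine mem_sup_sp.2 ⟨f, ?_⟩
    have := J.neg_mem hg
    convert this using 1; ring
  obtain ⟨h, hh⟩ := mem_sup_sp.1 this
  refine mem_sup_sp.2 ⟨h, h1 _ ?_⟩
  have := J.add_mem hg (J.mul_mem_left b hh)
  convert this using 1; ring

lemma idl_perm {L M : List (PolyS n × ℕ)} (h : L.Perm M) : ∀ J, idl J L = idl J M := by
  induction h with
  | nil => intro J; rfl
  | cons x _ ih => intro J; exact ih _
  | swap x y l => intro J; simp only [idl]; rw [sup_right_comm]
  | trans _ _ h1 h2 => intro J; rw [h1, h2]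

lemma Good.perm {L M : List (PolyS n × ℕ)} (h : L.Perm M) (hL : Good L) : Good M :=
  fun a ha => hL a (h.mem_iff.2 ha)

lemma regOn_perm {L M : List (PolyS n × ℕ)} (h : L.Perm M) :
    ∀ J, HomI J → Good L → RegOn J L → RegOn J M := by
  induction h with
  | nil => intro J _ _ _; trivial
  | cons x _ ih =>
    intro J hJ hL hr
    exact ⟨hr.1, ih _ (hJ.sup (hL x (by simp)).1) (fun a ha => hL a (by simp [ha])) hr.2⟩
  | swap x y l =>
    intro J hJ hL hr
    obtain ⟨h1, h2, h3⟩ := hr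
    have hy := hL y (by simp)
    have hx := hL x (by simp)
    refine ⟨nzd_swap1 hJ hy.1 hx.1 hy.2 h1 h2, nzd_swap2 h1 h2, ?_⟩
    rw [sup_right_comm]; exact h3
  | trans p1 _ h1 h2 =>
    intro J hJ hL hr
    exact h2 J hJ (hL.perm p1) (h1 J hJ hL hr)

lemma regOn_append {L M : List (PolyS n × ℕ)} :
    ∀ J, RegOn J (L ++ M) ↔ RegOn J L ∧ RegOn (idl J L) M := by
  induction L with
  | nil => intro J; simp [RegOn, idl]
  | cons a L ih => intro J; simp [RegOn, idl, ih, and_assoc]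

lemma idl_append {L M : List (PolyS n × ℕ)} :
    ∀ J, idl J (L ++ M) = idl (idl J L) M := by
  induction L with
  | nil => intro J; rfl
  | cons a L ih => intro J; simp [idl, ih]

lemma HomI.idl {L : List (PolyS n × ℕ)} :
    ∀ J, HomI J → Good L → HomI (idl J L) := by
  induction L with
  | nil => intro J h _; exact h
  | cons a L ih =>
    intro J hJ hL
    exact ih _ (hJ.sup (hL a (by simp)).1) (fun b hb => hL b (by simp [hb]))

/-- the irrelevant ideal -/
noncomputable def mm (n : ℕ) : Ideal (PolyS n) := Ideal.span (Set.range X)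

lemma mem_mm {a : PolyS n} {p : ℕ} (ha : a.IsHomogeneous p) (hp : 1 ≤ p) : a ∈ mm n := by
  rw [mm, ← Set.image_univ, mem_ideal_span_X_image]
  intro m hm
  have h := ha (mem_support_iff.1 hm)
  by_contra hcon
  push Not at hcon
  have : m = 0 := by ext i; simpa using hcon i (Set.mem_univ i)
  subst this
  simp at h
  omega

lemma mm_ne_top : mm n ≠ ⊤ := by
  intro h
  have : (1 : PolyS n) ∈ mm n := h ▸ Submodule.mem_top
  rw [mm, ← Set.image_univ, mem_ideal_span_X_image] at this
  obtain ⟨i, _, hi⟩ := this 0 (by simp)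
  simp at hi

lemma mm_le_iff {I : Ideal (PolyS n)} : mm n ≤ I ↔ ∀ i, X i ∈ I := by
  rw [mm, Ideal.span_le]
  exact ⟨fun h i => h ⟨i, rfl⟩, fun h => by rintro _ ⟨i, rfl⟩; exact h i⟩

/-- elements multiplied into `I` by the variables are multiplied into `I` by `mm`. -/
lemma mul_mem_of_X {I : Ideal (PolyS n)} {f a : PolyS n} (h : ∀ i, X i * f ∈ I)
    (ha : a ∈ mm n) : a * f ∈ I := by
  have : mm n ≤ Submodule.comap (LinearMap.mulRight (PolyS n) f) I := by
    rw [mm_le_iff]; intro i; simpa using h i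
  simpa using this ha

lemma idl_le_mm {L : List (PolyS n × ℕ)} :
    ∀ J, J ≤ mm n → Good L → idl J L ≤ mm n := by
  induction L with
  | nil => intro J h _; exact h
  | cons a L ih =>
    intro J hJ hL
    have ha := hL a (by simp)
    refine ih _ (sup_le hJ ?_) (fun b hb => hL b (by simp [hb]))
    rw [Ideal.span_singleton_le_iff_mem]
    exact mem_mm ha.1 ha.2

instance fin_grade (k : ℕ) : Module.Finite ℂ (polyGrade n k) :=
  Module.Finite.iff_fg.2 (homogeneousSubmodule_fg _ _ k)

/-- existence of a linear nonzerodivisor -/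
lemma exists_linear {J : Ideal (PolyS n)} {a : PolyS n} (ham : a ∈ mm n) (ha : Nzd J a) :
    ∃ y : PolyS n, y.IsHomogeneous 1 ∧ Nzd J y := by
  classical
  have hiff : ∀ y : PolyS n, IsSMulRegular (PolyS n ⧸ J) y ↔ Nzd J y := fun y => by
    rw [isSMulRegular_quotient_iff_mem_of_smul_mem]; rfl
  have hfin := associatedPrimes.finite (PolyS n) (PolyS n ⧸ J)
  have hU := biUnion_associatedPrimes_eq_compl_regular (PolyS n) (PolyS n ⧸ J)
  let φ : Ideal (PolyS n) → Submodule ℂ (polyGrade n 1) := fun p =>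
    Submodule.comap (polyGrade n 1).subtype (p.restrictScalars ℂ)
  have hne := Subspace.biUnion_ne_univ_of_top_notMem (k := ℂ) (E := polyGrade n 1)
    (s := hfin.toFinset.image φ) (by
      intro h
      obtain ⟨p, hp, hpt⟩ := Finset.mem_image.1 h
      have hp' := hfin.mem_toFinset.1 hp
      have : mm n ≤ p := by
        rw [mm_le_iff]
        intro i
        have : (⟨X i, isHomogeneous_X ℂ i⟩ : polyGrade n 1) ∈ φ p := hpt ▸ Submodule.mem_top
        exact this
      have h2 : a ∈ ⋃ p ∈ associatedPrimes (PolyS n) (PolyS n ⧸ J), (p : Set (PolyS n)) :=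
        Set.mem_iUnion₂_of_mem hp' (this ham)
      rw [hU] at h2
      exact h2 ((hiff a).2 ha))
  obtain ⟨y, hy⟩ := (Set.ne_univ_iff_exists_notMem _).1 hne
  refine ⟨y, y.2, (hiff _).1 ?_⟩
  by_contra hcon
  have : (y : PolyS n) ∈ ({r : PolyS n | IsSMulRegular (PolyS n ⧸ J) r}ᶜ : Set _) := hcon
  rw [← hU] at this
  obtain ⟨p, hp, hyp⟩ := Set.mem_iUnion₂.1 this
  apply hy
  exact Set.mem_iUnion₂_of_mem
    (Finset.mem_image_of_mem φ (hfin.mem_toFinset.2 hp)) hyp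

lemma qmk_zero {I : Ideal (PolyS n)} {k : ℕ} (f : polyGrade n k) :
    (Submodule.Quotient.mk f : quotPiece n I k) = 0 ↔ (f : PolyS n) ∈ I :=
  Submodule.Quotient.mk_eq_zero _

lemma qmk_eq {I : Ideal (PolyS n)} {k : ℕ} (f g : polyGrade n k) :
    (Submodule.Quotient.mk f : quotPiece n I k) = Submodule.Quotient.mk g ↔
      (f : PolyS n) - (g : PolyS n) ∈ I :=
  Submodule.Quotient.eq _

/-- The socle of `S/I` is one-dimensional and sits in degree `s`. -/
def SocOK (I : Ideal (PolyS n)) (s : ℕ) : Prop :=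
  ∃ u : PolyS n, u.IsHomogeneous s ∧ u ∉ I ∧ (∀ i, X i * u ∈ I) ∧
    ∀ k (f : PolyS n), f.IsHomogeneous k → (∀ i, X i * f ∈ I) →
      f ∈ I ∨ (k = s ∧ ∃ c : ℂ, f - C c * u ∈ I)

/-- `S/I` vanishes in large degrees. -/
def NilOK (I : Ideal (PolyS n)) : Prop :=
  ∃ N, ∀ k, N ≤ k → ∀ f : PolyS n, f.IsHomogeneous k → f ∈ I

lemma soc_swap {J : Ideal (PolyS n)} (hJ : HomI J) {a b : PolyS n} {p q s t : ℕ}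
    (ha : a.IsHomogeneous p) (hb : b.IsHomogeneous q) (hp : 1 ≤ p) (hq : 1 ≤ q)
    (na : Nzd J a) (nb : Nzd J b) (hst : s + q = t + p)
    (h : SocOK (J ⊔ Ideal.span {a}) s) : SocOK (J ⊔ Ideal.span {b}) t := by
  obtain ⟨u, hu, hu0, hux, hsoc⟩ := h
  have h1 : b * u ∈ J ⊔ Ideal.span {a} := mul_mem_of_X hux (mem_mm hb hq)
  rcases mem_sup_hom hJ ha (hb.mul hu) h1 with h2 | ⟨m, v, hm, hv, h2⟩
  · exact absurd (Submodule.mem_sup_left (nb _ h2)) hu0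
  obtain rfl : m = t := by omega
  refine ⟨v, hv, ?_, ?_, ?_⟩
  · intro hvb
    obtain ⟨w, hw⟩ := mem_sup_sp.1 hvb
    apply hu0
    refine mem_sup_sp.2 ⟨w, nb _ ?_⟩
    convert J.add_mem h2 (J.mul_mem_left a hw) using 1; ring
  · intro i
    obtain ⟨w, hw⟩ := mem_sup_sp.1 (hux i)
    refine mem_sup_sp.2 ⟨w, na _ ?_⟩
    convert J.sub_mem (J.mul_mem_left b hw) (J.mul_mem_left (X i) h2) using 1; ring
  · intro k g hg hgx
    have h3 : a * g ∈ J ⊔ Ideal.span {b} := mul_mem_of_X hgx (mem_mm ha hp)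
    rcases mem_sup_hom hJ hb (ha.mul hg) h3 with h4 | ⟨l, f, hl, hf, h4⟩
    · exact Or.inl (Submodule.mem_sup_left (na _ h4))
    have hfx : ∀ i, X i * f ∈ J ⊔ Ideal.span {a} := by
      intro i
      obtain ⟨w, hw⟩ := mem_sup_sp.1 (hgx i)
      refine mem_sup_sp.2 ⟨w, nb _ ?_⟩
      convert J.sub_mem (J.mul_mem_left a hw) (J.mul_mem_left (X i) h4) using 1; ring
    rcases hsoc l f hf hfx with h5 | ⟨hls, c, h5⟩
    · left
      obtain ⟨w, hw⟩ := mem_sup_sp.1 h5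
      refine mem_sup_sp.2 ⟨w, na _ ?_⟩
      convert J.add_mem h4 (J.mul_mem_left b hw) using 1; ring
    · right
      refine ⟨by omega, c, ?_⟩
      obtain ⟨w, hw⟩ := mem_sup_sp.1 h5
      refine mem_sup_sp.2 ⟨w, na _ ?_⟩
      convert J.add_mem (J.add_mem h4 (J.mul_mem_left b hw)) (J.mul_mem_left (C c) h2)
        using 1; ring

/-- multiplication by `a` on graded pieces of `S/J`. -/
noncomputable def mulMap (J : Ideal (PolyS n)) {a : PolyS n} {p : ℕ} (ha : a.IsHomogeneous p)
    (k : ℕ) : quotPiece n J k →ₗ[ℂ] quotPiece n J (k + p) :=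
  Submodule.mapQ _ _
    (((LinearMap.mulLeft ℂ a).comp (polyGrade n k).subtype).codRestrict (polyGrade n (k + p))
      (fun f => by
        have : (f : PolyS n).IsHomogeneous k := f.2
        have := ha.mul this
        rw [add_comm p k] at this
        exact this))
    (by
      intro f hf
      exact J.mul_mem_left a hf)

lemma mul_grade {a f : PolyS n} {p k : ℕ} (ha : a.IsHomogeneous p) (hf : f.IsHomogeneous k) :
    (a * f).IsHomogeneous (k + p) := by
  have := ha.mul hf
  rwa [add_comm p k] at this

lemma mulMap_mk (J : Ideal (PolyS n)) {a : PolyS n} {p : ℕ} (ha : a.IsHomogeneous p)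
    (k : ℕ) (f : polyGrade n k) :
    mulMap J ha k (Submodule.Quotient.mk f) =
      Submodule.Quotient.mk (⟨a * f, mul_grade ha f.2⟩ : polyGrade n (k + p)) := rfl

lemma mulMap_inj {J : Ideal (PolyS n)} {a : PolyS n} {p : ℕ} (ha : a.IsHomogeneous p)
    (k : ℕ) (na : Nzd J a) : Function.Injective (mulMap J ha k) := by
  rw [injective_iff_map_eq_zero]
  intro x hx
  obtain ⟨f, rfl⟩ := Submodule.Quotient.mk_surjective _ x
  rw [mulMap_mk, qmk_zero] at hx
  rw [qmk_zero]
  exact na _ hx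

lemma mulMap_surj_iff {J : Ideal (PolyS n)} (hJ : HomI J) {a : PolyS n} {p : ℕ}
    (ha : a.IsHomogeneous p) (k : ℕ) :
    Function.Surjective (mulMap J ha k) ↔
      ∀ f : PolyS n, f.IsHomogeneous (k + p) → f ∈ J ⊔ Ideal.span {a} := by
  constructor
  · intro h f hf
    obtain ⟨x, hx⟩ := h (Submodule.Quotient.mk ⟨f, hf⟩)
    obtain ⟨g, rfl⟩ := Submodule.Quotient.mk_surjective _ x
    rw [mulMap_mk] at hx
    have := (qmk_eq _ _).1 hx.symm
    exact mem_sup_sp.2 ⟨g, this⟩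
  · intro h y
    obtain ⟨f, rfl⟩ := Submodule.Quotient.mk_surjective _ y
    rcases mem_sup_hom hJ ha f.2 (h f f.2) with h1 | ⟨m, g, hm, hg, h1⟩
    · refine ⟨0, ?_⟩
      rw [map_zero]
      exact ((qmk_zero _).2 h1).symm
    · obtain rfl : m = k := by omega
      refine ⟨Submodule.Quotient.mk ⟨g, hg⟩, ?_⟩
      rw [mulMap_mk]
      symm
      rw [qmk_eq]
      exact h1

lemma nil_swap {J : Ideal (PolyS n)} (hJ : HomI J) {y b : PolyS n} {q : ℕ}
    (hy : y.IsHomogeneous 1) (hb : b.IsHomogeneous q)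
    (ny : Nzd J y) (nb : Nzd J b)
    (h : NilOK (J ⊔ Ideal.span {y})) : NilOK (J ⊔ Ideal.span {b}) := by
  obtain ⟨N, hN⟩ := h
  have h1 : ∀ k, N ≤ k → Module.finrank ℂ (quotPiece n J (k + 1)) =
      Module.finrank ℂ (quotPiece n J k) := by
    intro k hk
    exact (LinearEquiv.ofBijective (mulMap J hy k) ⟨mulMap_inj hy k ny,
      (mulMap_surj_iff hJ hy k).2 (hN _ (by omega))⟩).finrank_eq.symm
  have h2 : ∀ k, N ≤ k → ∀ q, Module.finrank ℂ (quotPiece n J (k + q)) =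
      Module.finrank ℂ (quotPiece n J k) := by
    intro k hk q
    induction q with
    | zero => rfl
    | succ q ih => rw [← ih]; exact h1 (k + q) (by omega)
  refine ⟨N + q, fun k hk f hf => ?_⟩
  obtain ⟨m, rfl⟩ := Nat.exists_eq_add_of_le' (le_trans (Nat.le_add_left q N) hk)
  have := (LinearMap.injective_iff_surjective_of_finrank_eq_finrank
    (h2 m (by omega) q).symm).1 (mulMap_inj hb m nb)
  exact (mulMap_surj_iff hJ hb m).1 this f hf

/-- the degree one part of an ideal -/
noncomputable def lin (J : Ideal (PolyS n)) : Submodule ℂ (polyGrade n 1) :=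
  Submodule.comap (polyGrade n 1).subtype (J.restrictScalars ℂ)

lemma lin_growth {L : List (PolyS n × ℕ)} : ∀ J : Ideal (PolyS n), J ≤ mm n → Good L →
    (∀ a ∈ L, a.2 = 1) → RegOn J L →
    Module.finrank ℂ (lin J) + L.length ≤ Module.finrank ℂ (lin (idl J L)) := by
  induction L with
  | nil => intro J _ _ _ _; exact le_refl _
  | cons a L ih =>
    intro J hJ hL h1 hr
    have ha := hL a (by simp)
    have haJ : a.1 ∉ J := by
      intro h
      have : (1 : PolyS n) ∈ J := hr.1 1 (by simpa using h)
      exact mm_ne_top ((Ideal.eq_top_iff_one _).2 (hJ this))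
    have ha1 : a.1.IsHomogeneous 1 := by
      have := ha.1
      rwa [h1 a (by simp)] at this
    have hlt : lin J < lin (J ⊔ Ideal.span {a.1}) := by
      refine lt_of_le_of_ne (fun x hx => Submodule.mem_sup_left (hx : (x : PolyS n) ∈ J)) ?_
      intro heq
      have : (⟨a.1, ha1⟩ : polyGrade n 1) ∈ lin (J ⊔ Ideal.span {a.1}) :=
        Submodule.mem_sup_right (Ideal.subset_span (Set.mem_singleton a.1))
      rw [← heq] at this
      exact haJ this
    have h2 := Submodule.finrank_lt_finrank_of_lt hlt
    have h3 := ih (J ⊔ Ideal.span {a.1})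
      (sup_le hJ ((Ideal.span_singleton_le_iff_mem _).2 (mem_mm ha.1 ha.2)))
      (fun b hb => hL b (by simp [hb])) (fun b hb => h1 b (by simp [hb])) hr.2
    change Module.finrank ℂ (lin J) + (L.length + 1) ≤
      Module.finrank ℂ (lin (idl (J ⊔ Ideal.span {a.1}) L))
    omega

lemma finrank_lin_le : Module.finrank ℂ (polyGrade n 1) ≤ n + 1 := by
  rw [polyGrade, homogeneousSubmodule_one_eq_span_X]
  have := finrank_range_le_card (R := ℂ) (X : Fin (n + 1) → PolyS n)
  rw [Fintype.card_fin] at this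
  exact this

lemma base_case {L : List (PolyS n × ℕ)} (hL : Good L) (h1 : ∀ a ∈ L, a.2 = 1)
    (hr : RegOn ⊥ L) (hlen : L.length = n + 1) : idl ⊥ L = mm n := by
  apply le_antisymm (idl_le_mm _ bot_le hL)
  have h2 := lin_growth ⊥ bot_le hL h1 hr
  have h3 := finrank_lin_le (n := n)
  have h4 : lin (idl ⊥ L) = ⊤ := Submodule.eq_top_of_finrank_eq
    (le_antisymm (Submodule.finrank_le _) (by omega))
  rw [mm_le_iff]
  intro i
  have : (⟨X i, isHomogeneous_X ℂ i⟩ : polyGrade n 1) ∈ lin (idl ⊥ L) := h4 ▸ Submodule.mem_top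
  exact this

lemma soc_mm : SocOK (mm n) 0 := by
  refine ⟨1, isHomogeneous_one _ _, fun h => mm_ne_top ((Ideal.eq_top_iff_one _).2 h), ?_, ?_⟩
  · intro i; rw [mul_one]; exact Ideal.subset_span ⟨i, rfl⟩
  · intro k f hf _
    rcases Nat.eq_zero_or_pos k with rfl | hk
    · right
      refine ⟨rfl, coeff 0 f, ?_⟩
      rw [← homogeneousComponent_zero, hc_self hf, mul_one, sub_self]
      exact zero_mem _
    · exact Or.inl (mem_mm hf hk)

lemma nil_mm : NilOK (mm n) := ⟨1, fun _ hk _ hf => mem_mm hf hk⟩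

lemma chain (L : List (PolyS n × ℕ)) : ∀ (Y : List (PolyS n × ℕ)), Good (Y ++ L) →
    (∀ a ∈ Y, a.2 = 1) → RegOn ⊥ (Y ++ L) → (Y ++ L).length = n + 1 →
    ∀ s, s + (n + 1) = ((Y ++ L).map Prod.snd).sum →
    SocOK (idl ⊥ (Y ++ L)) s ∧ NilOK (idl ⊥ (Y ++ L)) := by
  induction L with
  | nil =>
    intro Y hG h1 hr hlen s hs
    rw [List.append_nil] at *
    rw [base_case hG h1 hr hlen]
    have h2 : (Y.map Prod.snd).sum = n + 1 := by
      rw [← hlen, List.sum_eq_card_nsmul _ 1 (by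
        intro x hx
        obtain ⟨a, ha, rfl⟩ := List.mem_map.1 hx
        exact h1 a ha)]
      simp
    obtain rfl : s = 0 := by omega
    exact ⟨soc_mm, nil_mm⟩
  | cons a L ih =>
    intro Y hG h1 hr hlen s hs
    have hperm : (Y ++ a :: L).Perm ((Y ++ L) ++ [a]) :=
      List.perm_middle.trans (List.perm_append_singleton a (Y ++ L)).symm
    have hr' := regOn_perm hperm ⊥ homI_bot hG hr
    have hG' := hG.perm hperm
    have ha := hG a (by simp)
    rw [regOn_append] at hr'
    have na : Nzd (idl ⊥ (Y ++ L)) a.1 := hr'.2.1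
    have hGYL : Good (Y ++ L) := fun b hb => hG' b (List.mem_append_left _ hb)
    have hJ : HomI (idl ⊥ (Y ++ L)) := HomI.idl ⊥ homI_bot hGYL
    obtain ⟨y, hy, ny⟩ := exists_linear (mem_mm ha.1 ha.2) na
    have hperm2 : ((Y ++ L) ++ [(y, 1)]).Perm (((y, 1) :: Y) ++ L) :=
      List.perm_append_singleton _ _
    have hGy : Good ((Y ++ L) ++ [(y, 1)]) := by
      intro b hb
      rcases List.mem_append.1 hb with hb | hb
      · exact hGYL b hb
      · rw [List.mem_singleton] at hb; subst hb; exact ⟨hy, le_refl 1⟩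
    have hry : RegOn ⊥ ((Y ++ L) ++ [(y, 1)]) := by
      rw [regOn_append]; exact ⟨hr'.1, ny, trivial⟩
    have hsum : ((Y ++ a :: L).map Prod.snd).sum = ((Y ++ L).map Prod.snd).sum + a.2 := by
      simp only [List.map_append, List.sum_append, List.map_cons, List.sum_cons]; omega
    have hlen' : (Y ++ L).length = n := by
      simp only [List.length_append, List.length_cons] at hlen ⊢; omega
    have hge : n ≤ ((Y ++ L).map Prod.snd).sum := by
      have := List.length_le_sum_of_one_le ((Y ++ L).map Prod.snd) (by
        intro x hx
        obtain ⟨b, hb, rfl⟩ := List.mem_map.1 hx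
        exact (hGYL b hb).2)
      rw [List.length_map, hlen'] at this
      exact this
    obtain ⟨t, ht⟩ := Nat.exists_eq_add_of_le' hge
    have := ih ((y, 1) :: Y) (hGy.perm hperm2) (by
      intro b hb
      rcases List.mem_cons.1 hb with rfl | hb
      · rfl
      · exact h1 b hb) (regOn_perm hperm2 ⊥ homI_bot hGy hry)
      (by rw [List.cons_append, List.length_cons, hlen']) t
      (by rw [List.cons_append, List.map_cons, List.sum_cons, ht]; ring)
    rw [← idl_perm hperm2, idl_append] at this
    rw [idl_perm hperm, idl_append]
    exact ⟨soc_swap hJ hy ha.1 (le_refl 1) ha.2 ny na (by omega) this.1,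
      nil_swap hJ hy ha.1 ny na this.2⟩

lemma idl_eq (L : List (PolyS n × ℕ)) : ∀ J, idl J L = J ⊔ Ideal.ofList (L.map Prod.fst) := by
  induction L with
  | nil => intro J; simp [idl]
  | cons a L ih => intro J; rw [idl, ih, List.map_cons, Ideal.ofList_cons, sup_assoc]

lemma regOn_of (L : List (PolyS n × ℕ)) : ∀ J, (∀ i (h : i < L.length),
    Nzd (J ⊔ Ideal.ofList ((L.map Prod.fst).take i)) (L[i]).1) → RegOn J L := by
  induction L with
  | nil => intro J _; trivial
  | cons a L ih =>
    intro J h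
    have h0 : Nzd (J ⊔ Ideal.ofList []) a.1 := h 0 (Nat.succ_pos _)
    rw [Ideal.ofList_nil, sup_bot_eq] at h0
    refine ⟨h0, ih _ fun i hi => ?_⟩
    have := h (i + 1) (by simpa using hi)
    simpa [Ideal.ofList_cons, sup_assoc] using this


lemma main_facts (P : Fin (n + 1) → PolyS n) (d : Fin (n + 1) → ℕ)
    (hd : ∀ i, 1 ≤ d i) (hP : ∀ i, (P i).IsHomogeneous (d i))
    (hreg : RingTheory.Sequence.IsRegular (PolyS n) (List.ofFn P))
    (σ : ℕ) (hσ : σ + (n + 1) = ∑ i, d i) :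
    SocOK (Ideal.span (Set.range P)) σ ∧ NilOK (Ideal.span (Set.range P)) ∧
      HomI (Ideal.span (Set.range P)) := by
  set L : List (PolyS n × ℕ) := List.ofFn fun i => (P i, d i) with hLdef
  have hfst : L.map Prod.fst = List.ofFn P := by rw [hLdef, List.map_ofFn]; rfl
  have hsnd : L.map Prod.snd = List.ofFn d := by rw [hLdef, List.map_ofFn]; rfl
  have hG : Good L := by
    intro a ha
    rw [hLdef, List.mem_ofFn] at ha
    obtain ⟨i, rfl⟩ := ha
    exact ⟨hP i, hd i⟩
  have hr : RegOn ⊥ L := by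
    apply regOn_of
    intro i hi
    have h2 := hreg.regular_mod_prev i (by rw [← hfst]; simpa using hi)
    rw [isSMulRegular_quotient_iff_mem_of_smul_mem] at h2
    intro f hf
    rw [bot_sup_eq, hfst] at hf ⊢
    have := h2 f (by
      simp only [smul_eq_mul, Ideal.mul_top]
      convert hf using 2
      simp only [hLdef, List.getElem_ofFn])
    simpa using this
  have hI : idl ⊥ L = Ideal.span (Set.range P) := by
    rw [idl_eq, bot_sup_eq, hfst, Ideal.ofList]
    congr 1
    ext x
    exact List.mem_ofFn
  have := chain L [] hG (by simp) hr (by simp [hLdef]) σ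
    (by rw [List.nil_append, hsnd, List.sum_ofFn, hσ])
  rw [List.nil_append, hI] at this
  exact ⟨this.1, this.2, hI ▸ HomI.idl ⊥ homI_bot hG⟩

lemma top_zero {I : Ideal (PolyS n)} {s : ℕ} (h1 : SocOK I s) (h2 : NilOK I) :
    ∀ k, s < k → ∀ f : PolyS n, f.IsHomogeneous k → f ∈ I := by
  obtain ⟨u, -, -, -, hsoc⟩ := h1
  obtain ⟨N, hN⟩ := h2
  have : ∀ r k, s < k → N ≤ k + r → ∀ f : PolyS n, f.IsHomogeneous k → f ∈ I := by
    intro r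
    induction r with
    | zero => intro k _ hk f hf; exact hN k hk f hf
    | succ r ih =>
      intro k hk hr f hf
      rcases hsoc k f hf (fun i => ih (1 + k) (by omega) (by omega) _
        ((isHomogeneous_X ℂ i).mul hf)) with h | ⟨h, _⟩
      · exact h
      · omega
  intro k hk
  exact this N k hk (by omega)

lemma nondeg {I : Ideal (PolyS n)} {s : ℕ} (h1 : SocOK I s) :
    ∀ m j, j + m = s → ∀ f : PolyS n, f.IsHomogeneous j → f ∉ I →
      ∃ g : PolyS n, g.IsHomogeneous m ∧ f * g ∉ I := by
  obtain ⟨u, -, -, -, hsoc⟩ := h1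
  intro m
  induction m with
  | zero => intro j _ f _ hfI; exact ⟨1, isHomogeneous_one _ _, by simpa using hfI⟩
  | succ m ih =>
    intro j hj f hf hfI
    have : ∃ i, X i * f ∉ I := by
      by_contra hcon
      push Not at hcon
      rcases hsoc j f hf hcon with h | ⟨h, _⟩
      · exact hfI h
      · omega
    obtain ⟨i, hi⟩ := this
    obtain ⟨g, hg, hgI⟩ := ih (1 + j) (by omega) _ ((isHomogeneous_X ℂ i).mul hf) hi
    refine ⟨X i * g, ?_, ?_⟩
    · rw [add_comm m 1]; exact (isHomogeneous_X ℂ i).mul hg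
    · convert hgI using 1; ring_nf

lemma finrank_top {I : Ideal (PolyS n)} {s : ℕ} (h1 : SocOK I s) (h2 : NilOK I) :
    Module.finrank ℂ (quotPiece n I s) = 1 := by
  have h3 := top_zero h1 h2
  obtain ⟨u, hu, hu0, hux, hsoc⟩ := h1
  refine finrank_eq_one (Submodule.Quotient.mk ⟨u, hu⟩) ?_ ?_
  · intro h
    exact hu0 ((qmk_zero _).1 h)
  · intro w
    obtain ⟨f, rfl⟩ := Submodule.Quotient.mk_surjective _ w
    have hf : (f : PolyS n).IsHomogeneous s := f.2
    rcases hsoc s f hf (fun i => h3 (1 + s) (by omega) _ ((isHomogeneous_X ℂ i).mul hf)) with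
      h | ⟨-, c, h⟩
    · refine ⟨0, ?_⟩
      rw [zero_smul]
      exact ((qmk_zero _).2 h).symm
    · refine ⟨c, ?_⟩
      rw [← Submodule.Quotient.mk_smul]
      refine ((qmk_eq _ _).2 ?_).symm
      show (f : PolyS n) - c • u ∈ I
      rwa [smul_eq_C_mul]

lemma pairing_bij {I : Ideal (PolyS n)} {s : ℕ} (h1 : SocOK I s) (h2 : NilOK I) (j m : ℕ)
    (hjm : j + m = s) (B : quotPiece n I j →ₗ[ℂ] quotPiece n I m →ₗ[ℂ] quotPiece n I s)
    (hB : IsMulPairing n I j m s hjm B) : Function.Bijective B := by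
  have hinj : Function.Injective B := by
    rw [injective_iff_map_eq_zero]
    intro x hx
    obtain ⟨f, rfl⟩ := Submodule.Quotient.mk_surjective _ x
    rw [qmk_zero]
    by_contra hf
    obtain ⟨g, hg, hgI⟩ := nondeg h1 m j hjm f f.2 hf
    have := hB f ⟨g, hg⟩
    rw [hx] at this
    exact hgI ((qmk_zero _).1 this.symm)
  have hinj2 : Function.Injective B.flip := by
    rw [injective_iff_map_eq_zero]
    intro x hx
    obtain ⟨f, rfl⟩ := Submodule.Quotient.mk_surjective _ x
    rw [qmk_zero]
    by_contra hf
    obtain ⟨g, hg, hgI⟩ := nondeg h1 j m (by omega) f f.2 hf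
    have := hB ⟨g, hg⟩ f
    rw [← LinearMap.flip_apply, hx] at this
    have := (qmk_zero _).1 this.symm
    apply hgI
    rw [mul_comm]
    exact this
  have hr := finrank_top h1 h2
  have e1 := LinearMap.finrank_le_finrank_of_injective hinj
  have e2 := LinearMap.finrank_le_finrank_of_injective hinj2
  rw [Module.finrank_linearMap, hr, mul_one] at e1 e2
  refine ⟨hinj, (LinearMap.injective_iff_surjective_of_finrank_eq_finrank ?_).1 hinj⟩
  rw [Module.finrank_linearMap, hr, mul_one]
  omega

end Macaulay

/-- for a regular sequence `P_0,…,P_n` of homogeneous polynomials of degrees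
`d_0,…,d_n ≥ 1` in `ℂ[x_0,…,x_n]`, with `I = (P_0,…,P_n)` and `σ = (Σ dᵢ) − (n+1)`, for
every `0 ≤ j ≤ σ` the multiplication pairing `(S/I)_j × (S/I)_{σ−j} → (S/I)_σ` is perfect:
the induced linear map `(S/I)_j → Hom_ℂ((S/I)_{σ−j}, (S/I)_σ)` is bijective. -/
theorem statement6 (n : ℕ) (P : Fin (n + 1) → PolyS n) (d : Fin (n + 1) → ℕ)
    (hd : ∀ i, 1 ≤ d i) (hP : ∀ i, (P i).IsHomogeneous (d i))
    (hreg : RingTheory.Sequence.IsRegular (PolyS n) (List.ofFn P))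
    (I : Ideal (PolyS n)) (hI : I = Ideal.span (Set.range P))
    (σ : ℕ) (hσ : (σ : ℤ) = (∑ i, (d i : ℤ)) - (n + 1)) :
    ∀ j (hj : j ≤ σ),
      ∀ B : quotPiece n I j →ₗ[ℂ] quotPiece n I (σ - j) →ₗ[ℂ] quotPiece n I σ,
        IsMulPairing n I j (σ - j) σ (Nat.add_sub_cancel' hj) B → Function.Bijective B := by
  intro j hj B hB
  subst hI
  have h : σ + (n + 1) = ∑ i, d i := by
    have : ((σ + (n + 1) : ℕ) : ℤ) = ((∑ i, d i : ℕ) : ℤ) := by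
      push_cast; rw [hσ]; ring
    exact_mod_cast this
  obtain ⟨h1, h2, -⟩ := Macaulay.main_facts P d hd hP hreg σ h
  exact Macaulay.pairing_bij h1 h2 j (σ - j) _ B hB
end

section
/- Let S = ℂ[x_0,…,x_n] with n ≥ 1, let m ≥ 1 be an integer, and let V ⊆ S_m be a ℂ-subspace of codimension 1 in S_m which is base point free, i.e., the only point x ∈ ℂ^{n+1} with F(x) = 0 for all F ∈ V is the origin. Then the ideal I' generated by V contains every homogeneous polynomial of degree m+1; equivalently, S_1·V = S_{m+1}. -/
open MvPolynomial in
/-- A monomial exponent of degree `k+1` splits off a variable. -/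
theorem exists_split {N : ℕ} (k : ℕ) (d : Fin N →₀ ℕ) (hd : d.degree = k + 1) :
    ∃ (i : Fin N) (e : Fin N →₀ ℕ), e.degree = k ∧
      (monomial d (1 : ℂ) : MvPolynomial (Fin N) ℂ) = X i * monomial e 1 := by
  have h0 : d ≠ 0 := by
    rintro rfl
    simp at hd
  obtain ⟨i, hi⟩ := Finsupp.ne_iff.mp h0
  have hle : Finsupp.single i 1 ≤ d := by
    rw [Finsupp.single_le_iff]
    exact Nat.one_le_iff_ne_zero.mpr hi
  have hsum : Finsupp.single i 1 + (d - Finsupp.single i 1) = d := add_tsub_cancel_of_le hle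
  refine ⟨i, d - Finsupp.single i 1, ?_, ?_⟩
  · have := congrArg Finsupp.degree hsum
    rw [map_add, hd, Finsupp.degree_single] at this
    omega
  · rw [X, monomial_mul, hsum, one_mul]

open MvPolynomial in
/-- Two linear functionals agreeing on monomials of degree `k` agree on homogeneous polynomials. -/
theorem lin_eq_of_monomial {N : ℕ} (k : ℕ) (f g : MvPolynomial (Fin N) ℂ →ₗ[ℂ] ℂ)
    (h : ∀ d : Fin N →₀ ℕ, d.degree = k → f (monomial d 1) = g (monomial d 1))
    (F : MvPolynomial (Fin N) ℂ) (hF : F.IsHomogeneous k) : f F = g F := by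
  rw [F.as_sum, map_sum, map_sum]
  refine Finset.sum_congr rfl fun d hd => ?_
  have hdeg : d.degree = k := by
    by_contra hne
    exact (mem_support_iff.mp hd) (hF.coeff_eq_zero hne)
  have : (monomial d (coeff d F) : MvPolynomial (Fin N) ℂ) = coeff d F • monomial d 1 := by
    rw [smul_monomial, smul_eq_mul, mul_one]
  rw [this, map_smul, map_smul, h d hdeg]

/-- if `V ⊆ S_m` is a base point free subspace of codimension 1 (`m ≥ 1`,
`n ≥ 1`), then the ideal generated by `V` contains every homogeneous polynomial of
degree `m+1`; equivalently `S_1·V = S_{m+1}`. -/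
theorem statement10 (n : ℕ) (hn : 1 ≤ n) (m : ℕ) (hm : 1 ≤ m)
    (V : Submodule ℂ (PolyS n)) (hVle : V ≤ polyGrade n m)
    (hcodim : Module.finrank ℂ (polyGrade n m) = Module.finrank ℂ V + 1)
    (hbpf : ∀ x : Fin (n + 1) → ℂ, (∀ F ∈ V, MvPolynomial.eval x F = 0) → x = 0) :
    ∀ F : PolyS n, F.IsHomogeneous (m + 1) → F ∈ Ideal.span (V : Set (PolyS n)) := by
  intro F hF
  by_contra hFn
  have hfin : Module.Finite ℂ (polyGrade n m) :=
    Module.finite_of_finrank_pos (by omega)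
  -- a functional killing the ideal
  obtain ⟨ψ, hψF, hψ⟩ := Submodule.exists_le_ker_of_notMem
    (p := (Ideal.span (V : Set (PolyS n))).restrictScalars ℂ) (v := F) hFn
  have hψV : ∀ (i : Fin (n + 1)), ∀ v ∈ V, ψ (MvPolynomial.X i * v) = 0 := fun i v hv =>
    hψ (Ideal.mul_mem_left _ _ (Ideal.subset_span hv) :
      MvPolynomial.X i * v ∈ Ideal.span (V : Set (PolyS n)))
  -- an element of `S_m` outside `V`
  obtain ⟨E, hE, hEV⟩ : ∃ E ∈ polyGrade n m, E ∉ V := by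
    by_contra! hcon
    have : V = polyGrade n m := le_antisymm hVle hcon
    rw [this] at hcodim
    omega
  obtain ⟨φ, hφE, hφ⟩ := Submodule.exists_le_ker_of_notMem hEV
  have hVeq : V = polyGrade n m ⊓ LinearMap.ker φ := by
    have hlt : polyGrade n m ⊓ LinearMap.ker φ < polyGrade n m :=
      lt_of_le_of_ne inf_le_left fun h => hφE (by
        have := h.symm ▸ hE
        exact this.2)
    have h1 := Submodule.finrank_lt_finrank_of_lt hlt
    have : Module.Finite ℂ (polyGrade n m ⊓ LinearMap.ker φ : Submodule ℂ (PolyS n)) :=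
      Submodule.finiteDimensional_of_le inf_le_left
    exact Submodule.eq_of_le_of_finrank_le (le_inf hVle hφ) (by omega)
  -- the key identity
  have key : ∀ i, ∀ G ∈ polyGrade n m,
      φ E * ψ (MvPolynomial.X i * G) = φ G * ψ (MvPolynomial.X i * E) := by
    intro i G hG
    have hv : φ E • G - φ G • E ∈ V := by
      rw [hVeq]
      refine ⟨Submodule.sub_mem _ (Submodule.smul_mem _ _ hG) (Submodule.smul_mem _ _ hE), ?_⟩
      change φ (φ E • G - φ G • E) = 0
      rw [map_sub, map_smul, map_smul, smul_eq_mul, smul_eq_mul]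
      ring
    have := hψV i _ hv
    rw [mul_sub, mul_smul_comm, mul_smul_comm, map_sub, map_smul, map_smul, smul_eq_mul,
      smul_eq_mul] at this
    exact sub_eq_zero.mp this
  set p : Fin (n + 1) → ℂ := fun i => ψ (MvPolynomial.X i * E) with hp
  have hmon : ∀ (k : ℕ) (d : Fin (n + 1) →₀ ℕ), d.degree = k →
      (MvPolynomial.monomial d (1 : ℂ)).IsHomogeneous k := fun k d hd =>
    MvPolynomial.isHomogeneous_monomial _ hd
  have hp0 : ∃ j, p j ≠ 0 := by
    by_contra! hcon
    apply hψF
    refine lin_eq_of_monomial (m + 1) ψ 0 (fun d hd => ?_) F hF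
    obtain ⟨i, e, he, hde⟩ := exists_split m d hd
    have := key i (MvPolynomial.monomial e 1) (hmon m e he)
    have h2 : ψ (MvPolynomial.X i * E) = 0 := hcon i
    rw [h2, mul_zero] at this
    rw [hde]
    exact (mul_eq_zero.mp this).resolve_left hφE
  obtain ⟨j, hj⟩ := hp0
  have swap : ∀ i, ∀ G : PolyS n, G.IsHomogeneous (m - 1) →
      p j * φ (MvPolynomial.X i * G) = p i * φ (MvPolynomial.X j * G) := by
    intro i G hG
    have hX : ∀ i, (MvPolynomial.X i * G).IsHomogeneous m := fun i => by
      have := (MvPolynomial.isHomogeneous_X ℂ i).mul hG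
      rwa [show 1 + (m - 1) = m by omega] at this
    have h1 := key j _ (hX i)
    have h2 := key i _ (hX j)
    rw [mul_left_comm] at h1
    rw [h1] at h2
    change φ _ * p j = φ _ * p i at h2
    linear_combination h2
  have main : ∀ k, k ≤ m → ∀ d : Fin (n + 1) →₀ ℕ, d.degree = k →
      p j ^ k * φ (MvPolynomial.monomial d 1 * MvPolynomial.X j ^ (m - k)) =
        MvPolynomial.eval p (MvPolynomial.monomial d 1) * φ (MvPolynomial.X j ^ m) := by
    intro k
    induction k with
    | zero =>
      intro _ d hd
      have : d = 0 := (Finsupp.degree_eq_zero_iff d).mp hd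
      subst this
      simp
    | succ k ih =>
      intro hk d hd
      obtain ⟨i, e, he, hde⟩ := exists_split k d hd
      have hI := ih (by omega) e he
      have hs := swap i (MvPolynomial.monomial e 1 * MvPolynomial.X j ^ (m - (k + 1))) (by
        have := (hmon k e he).mul (MvPolynomial.isHomogeneous_X_pow (R := ℂ) j (m - (k + 1)))
        rwa [show k + (m - (k + 1)) = m - 1 by omega] at this)
      have e1 : (MvPolynomial.X j * (MvPolynomial.monomial e (1 : ℂ) *
          MvPolynomial.X j ^ (m - (k + 1))) : PolyS n) =
          MvPolynomial.monomial e 1 * MvPolynomial.X j ^ (m - k) := by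
        rw [show m - k = (m - (k + 1)) + 1 by omega]
        ring
      rw [e1] at hs
      rw [hde, mul_assoc, (MvPolynomial.eval p).map_mul, MvPolynomial.eval_X, pow_succ, mul_assoc (p j ^ k), hs]
      linear_combination p i * hI
  have final : ∀ G : PolyS n, G.IsHomogeneous m →
      p j ^ m * φ G = MvPolynomial.eval p G * φ (MvPolynomial.X j ^ m) := by
    intro G hG
    have := lin_eq_of_monomial m (p j ^ m • φ)
      (φ (MvPolynomial.X j ^ m) • (MvPolynomial.aeval p).toLinearMap) (fun d hd => by
        have := main m le_rfl d hd
        simp only [Nat.sub_self, pow_zero, mul_one] at this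
        simp only [LinearMap.smul_apply, smul_eq_mul, AlgHom.toLinearMap_apply,
          MvPolynomial.coe_aeval_eq_eval]
        rw [this, mul_comm]; rfl) G hG
    simp only [LinearMap.smul_apply, smul_eq_mul, AlgHom.toLinearMap_apply,
          MvPolynomial.coe_aeval_eq_eval] at this
    rw [this, mul_comm]; rfl
  have hc : φ (MvPolynomial.X j ^ m) ≠ 0 := by
    intro h0
    have := final E hE
    rw [h0, mul_zero] at this
    exact (mul_ne_zero (pow_ne_zero _ hj) hφE) this
  apply hj
  rw [hbpf p fun v hv => ?_]
  · rfl
  · have := final v (hVle hv)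
    rw [show φ v = 0 from hφ hv, mul_zero] at this
    exact (mul_eq_zero.mp this.symm).resolve_right hc
end

section
/- Let k ≥ 1 and let S = ℂ[x_0,…,x_{2k+1}]. Let P_1, …, P_{k+1} be homogeneous polynomials of degrees d_1, …, d_{k+1} ≥ 1 and Q_1, …, Q_{k+1} homogeneous polynomials of degrees e − d_1, …, e − d_{k+1} ≥ 1, and set F = Σ_{i=1}^{k+1} P_i·Q_i (so F is homogeneous of degree e). Suppose the only point x ∈ ℂ^{2k+2} at which all partial derivatives ∂F/∂x_0, …, ∂F/∂x_{2k+1} vanish is the origin. Then P_1, …, P_{k+1}, Q_1, …, Q_{k+1} is a regular sequence in S; in particular the quotient S/(P_1,…,P_{k+1},Q_1,…,Q_{k+1}) is a finite-dimensional ℂ-vector space. -/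
/-- `a` is a nonzerodivisor modulo `J`. -/
def RegMod {R : Type*} [CommRing R] (J : Ideal R) (a : R) : Prop := ∀ x, a * x ∈ J → x ∈ J

/-- `p` is an associated prime of `R/J`. -/
def AssMod {R : Type*} [CommRing R] (J p : Ideal R) : Prop :=
  p.IsPrime ∧ ∃ z, ∀ r, r ∈ p ↔ r * z ∈ J

/-- `R/J` has `m`-depth at least `n`. -/
def DepMod {R : Type*} [CommRing R] (m : Ideal R) : ℕ → Ideal R → Prop
  | 0, _ => True
  | n + 1, J => ∃ a ∈ m, RegMod J a ∧ DepMod m n (J ⊔ Ideal.span {a})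

section
variable {R : Type*} [CommRing R]

lemma assMod_iff [IsNoetherianRing R] (J p : Ideal R) :
    AssMod J p ↔ IsAssociatedPrime p (R ⧸ J) := by
  rw [isAssociatedPrime_iff, AssMod]
  refine and_congr_right fun _ => ?_
  rw [(Ideal.Quotient.mk_surjective (I := J)).exists]
  refine exists_congr fun z => ?_
  rw [SetLike.ext_iff]
  refine forall_congr' fun r => ?_
  rw [Submodule.mem_colon_singleton, Submodule.mem_bot,
    ← Ideal.Quotient.eq_zero_iff_mem (I := J)]
  rfl

lemma exists_assMod [IsNoetherianRing R] {J : Ideal R} {z : R} (hz : z ∉ J) :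
    ∃ q, AssMod J q ∧ ∀ r, r * z ∈ J → r ∈ q := by
  obtain ⟨q, hq, h⟩ := exists_le_isAssociatedPrime_of_isNoetherianRing R
    (Ideal.Quotient.mk J z) (by rwa [Ne, Ideal.Quotient.eq_zero_iff_mem])
  refine ⟨q, (assMod_iff J q).2 hq, fun r hr => h ?_⟩
  rw [Submodule.mem_colon_singleton, Submodule.mem_bot]
  exact (Ideal.Quotient.eq_zero_iff_mem (I := J)).2 hr

lemma exists_assMod_of_not_reg [IsNoetherianRing R] {J : Ideal R} {a : R} (h : ¬ RegMod J a) :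
    ∃ q, AssMod J q ∧ a ∈ q := by
  unfold RegMod at h
  push Not at h
  obtain ⟨x, hx, hxJ⟩ := h
  obtain ⟨q, hq, h⟩ := exists_assMod hxJ
  exact ⟨q, hq, h a hx⟩

lemma finite_assMod [IsNoetherianRing R] (J : Ideal R) : {q | AssMod J q}.Finite := by
  have := associatedPrimes.finite R (R ⧸ J)
  convert this using 1
  ext q
  exact assMod_iff J q

lemma RegMod.not_mem {J q : Ideal R} {a : R} (h : RegMod J a) (hq : AssMod J q) : a ∉ q := by
  obtain ⟨hp, z, hz⟩ := hq
  intro ha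
  have := h z ((hz a).1 ha)
  exact hp.ne_top ((Ideal.eq_top_iff_one _).2 ((hz 1).2 (by simpa)))

/-- exchange of associated maximal ideals -/
lemma assMod_exchange {J m : Ideal R} {a b : R} (ham : a ∈ m) (hbm : b ∈ m) (hm : m.IsMaximal)
    (ha : RegMod J a) (hb : RegMod J b) (h : AssMod (J ⊔ Ideal.span {b}) m) :
    AssMod (J ⊔ Ideal.span {a}) m := by
  obtain ⟨hp, z, hz⟩ := h
  have key : ∀ c u : R, u ∈ J ⊔ Ideal.span {c} ↔ ∃ w, u - c * w ∈ J := by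
    intro c u
    rw [Submodule.mem_sup]
    constructor
    · rintro ⟨j, hj, y, hy, rfl⟩
      obtain ⟨w, rfl⟩ := Ideal.mem_span_singleton'.1 hy
      exact ⟨w, by convert hj using 1; ring⟩
    · rintro ⟨w, hw⟩
      exact ⟨_, hw, c * w, Ideal.mem_span_singleton'.2 ⟨w, mul_comm _ _⟩, by ring⟩
  obtain ⟨y, hy⟩ := (key _ _).1 ((hz a).1 ham)
  have h1 : ∀ r ∈ m, r * y ∈ J ⊔ Ideal.span {a} := by
    intro r hr
    obtain ⟨w, hw⟩ := (key _ _).1 ((hz r).1 hr)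
    refine (key _ _).2 ⟨w, hb _ ?_⟩
    have : b * (r * y - a * w) = a * (r * z - b * w) - r * (a * z - b * y) := by ring
    rw [this]
    exact sub_mem (Ideal.mul_mem_left _ _ hw) (Ideal.mul_mem_left _ _ hy)
  have h2 : y ∉ J ⊔ Ideal.span {a} := by
    intro h
    obtain ⟨w, hw⟩ := (key _ _).1 h
    have h3 : z - b * w ∈ J := by
      refine ha _ ?_
      have : a * (z - b * w) = (a * z - b * y) + b * (y - a * w) := by ring
      rw [this]
      exact add_mem hy (Ideal.mul_mem_left _ _ hw)
    have : (1 : R) ∈ m := (hz 1).2 ((key _ _).2 ⟨w, by simpa using h3⟩)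
    exact hm.ne_top ((Ideal.eq_top_iff_one _).2 this)
  refine ⟨hp, y, fun r => ⟨h1 r, fun hr => ?_⟩⟩
  by_contra hrm
  obtain ⟨s, t, ht, hst⟩ := hm.exists_inv hrm
  apply h2
  have : y = s * (r * y) + t * y := by
    rw [← mul_assoc, ← add_mul, hst, one_mul]
  rw [this]
  exact add_mem (Ideal.mul_mem_left _ _ hr) (h1 t ht)

lemma regMod_swap {J : Ideal R} {a c : R} (hc : RegMod J c) (hca : RegMod (J ⊔ Ideal.span {a}) c) :
    ∀ (_ : RegMod J a), RegMod (J ⊔ Ideal.span {c}) a := by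
  intro _ x hx
  obtain ⟨j, hj, y, hy, e⟩ := Submodule.mem_sup.1 hx
  obtain ⟨w, rfl⟩ := Ideal.mem_span_singleton'.1 hy
  have : w ∈ J ⊔ Ideal.span {a} := by
    apply hca
    have : c * w = a * x - j := by rw [← e]; ring
    rw [this]
    exact sub_mem (Ideal.mem_sup_right (Ideal.mul_mem_right _ _ (Ideal.mem_span_singleton_self a)))
      (Ideal.mem_sup_left hj)
  obtain ⟨j', hj', y', hy', e'⟩ := Submodule.mem_sup.1 this
  obtain ⟨w', rfl⟩ := Ideal.mem_span_singleton'.1 hy'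
  have h3 : x - c * w' ∈ J := by
    rename_i ha
    apply ha
    have : a * (x - c * w') = j + j' * c := by rw [mul_sub, ← e, ← e']; ring
    rw [this]
    exact add_mem hj (Ideal.mul_mem_right _ _ hj')
  refine Submodule.mem_sup.2 ⟨_, h3, c * w', Ideal.mem_span_singleton'.2 ⟨w', mul_comm _ _⟩, by ring⟩

lemma depMod_exchange [IsNoetherianRing R] {m : Ideal R} (hm : m.IsMaximal) (n : ℕ) :
    ∀ (J : Ideal R) (a b : R), a ∈ m → b ∈ m → RegMod J a → RegMod J b →
      DepMod m n (J ⊔ Ideal.span {a}) → DepMod m n (J ⊔ Ideal.span {b}) := by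
  induction n with
  | zero => intros; trivial
  | succ n ih =>
    rintro J a b ham hbm ha hb ⟨c', hc'm, hc', hd⟩
    have hma : ¬ AssMod (J ⊔ Ideal.span {a}) m := fun h => hc'.not_mem h hc'm
    have hmb : ¬ AssMod (J ⊔ Ideal.span {b}) m :=
      fun h => hma (assMod_exchange ham hbm hm ha hb h)
    have hmJ : ¬ AssMod J m := fun h => ha.not_mem h ham
    -- prime avoidance
    obtain ⟨c, hcm, hc⟩ : ∃ c ∈ m, ∀ q, (AssMod J q ∨ AssMod (J ⊔ Ideal.span {a}) q ∨
        AssMod (J ⊔ Ideal.span {b}) q) → c ∉ q := by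
      by_contra! hcon
      have hfin : ({q | AssMod J q} ∪ ({q | AssMod (J ⊔ Ideal.span {a}) q} ∪
        {q | AssMod (J ⊔ Ideal.span {b}) q})).Finite :=
        (finite_assMod _).union ((finite_assMod _).union (finite_assMod _))
      have := (Ideal.subset_union_prime_finite hfin (f := id) (I := m) ⊤ ⊤ ?_).1 ?_
      · obtain ⟨q, hq, hle⟩ := this
        have hqp : q.IsPrime := by
          rcases hq with h | h | h <;> exact h.1
        have : m = q := hm.eq_of_le hqp.ne_top hle
        subst this
        rcases hq with h | h | h
        exacts [hmJ h, hma h, hmb h]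
      · rintro q (h | h | h) _ _ <;> exact h.1
      · intro c hc
        obtain ⟨q, hq, hcq⟩ := hcon c hc
        exact Set.mem_iUnion₂.2 ⟨q, hq, hcq⟩
    have hreg : ∀ K : Ideal R, (∀ q, AssMod K q → c ∉ q) → RegMod K c := by
      intro K hK
      by_contra h
      obtain ⟨q, hq, hcq⟩ := exists_assMod_of_not_reg h
      exact hK q hq hcq
    have hcJ := hreg J fun q hq => hc q (Or.inl hq)
    have hca := hreg _ fun q hq => hc q (Or.inr (Or.inl hq))
    have hcb := hreg _ fun q hq => hc q (Or.inr (Or.inr hq))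
    refine ⟨c, hcm, hcb, ?_⟩
    have h1 := ih _ c' c hc'm hcm hc' hca hd
    rw [sup_right_comm] at h1 ⊢
    exact ih _ a b ham hbm (regMod_swap hcJ hca ha) (regMod_swap hcJ hcb hb) h1

lemma depMod_le_dim [IsNoetherianRing R] [IsLocalRing R] (n : ℕ) :
    ∀ (J p : Ideal R), AssMod J p → DepMod (IsLocalRing.maximalIdeal R) n J →
      (n : WithBot ℕ∞) ≤ ringKrullDim (R ⧸ p) := by
  induction n with
  | zero =>
    intro J p hp _
    have := hp.1
    exact_mod_cast ringKrullDim_nonneg_of_nontrivial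
  | succ n ih =>
    rintro J p hp ⟨a, ham, ha, hd⟩
    have hap := ha.not_mem hp
    obtain ⟨hpp, z, hz⟩ := hp
    -- N = J : p
    let N : Ideal R := J.colon p
    have hN : ∀ x, x ∈ N ↔ ∀ r ∈ p, r * x ∈ J := by
      intro x
      simp only [N, Submodule.mem_colon, smul_eq_mul, mul_comm x]
      rfl
    have hNn : ¬ N ≤ J ⊔ Ideal.span {a} := by
      intro hle
      have h1 : N ≤ J ⊔ Ideal.span {a} • N := by
        intro x hx
        obtain ⟨j, hj, y, hy, e⟩ := Submodule.mem_sup.1 (hle hx)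
        obtain ⟨w, rfl⟩ := Ideal.mem_span_singleton'.1 hy
        refine Submodule.mem_sup.2 ⟨j, hj, w * a, ?_, e⟩
        rw [mul_comm]
        refine Submodule.smul_mem_smul (Ideal.mem_span_singleton_self a) ((hN w).2 fun r hr => ha _ ?_)
        have : a * (r * w) = r * x - r * j := by rw [← e]; ring
        rw [this]
        exact sub_mem ((hN x).1 hx r hr) (Ideal.mul_mem_left _ _ hj)
      have h2 := Submodule.le_of_le_smul_of_le_jacobson_bot (IsNoetherian.noetherian N)
        ((Ideal.span_singleton_le_iff_mem _).2 (IsLocalRing.maximalIdeal_le_jacobson _ ham)) h1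
      have hzN : z ∈ N := (hN z).2 fun r hr => (hz r).1 hr
      exact hpp.ne_top ((Ideal.eq_top_iff_one _).2 ((hz 1).2 (by simpa using h2 hzN)))
    obtain ⟨y, hyN, hy⟩ := Set.not_subset.1 hNn
    obtain ⟨q, hq, hqa⟩ := exists_assMod hy
    have hpq : p ≤ q := fun r hr => hqa r (Ideal.mem_sup_left ((hN y).1 hyN r hr))
    have haq : a ∈ q := hqa a (Ideal.mem_sup_right
      (Ideal.mul_mem_right _ _ (Ideal.mem_span_singleton_self a)))
    have h3 := ih _ q hq hd
    have h4 := ringKrullDim_succ_le_of_surjective (Ideal.Quotient.factor hpq)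
      (Ideal.Quotient.factor_surjective hpq) (r := Ideal.Quotient.mk p a)
      (mem_nonZeroDivisors_of_ne_zero (by rwa [Ne, Ideal.Quotient.eq_zero_iff_mem]))
      (by simpa [Ideal.Quotient.eq_zero_iff_mem] using haq)
    refine le_trans ?_ h4
    push_cast
    gcongr

lemma dim_le_length [IsNoetherianRing R] [IsLocalRing R] (p : Ideal R) [p.IsPrime] (l : List R)
    (hl : ∀ q : Ideal R, q.IsPrime → p ≤ q → (∀ f ∈ l, f ∈ q) → q = IsLocalRing.maximalIdeal R)
    (hlm : ∀ f ∈ l, f ∈ IsLocalRing.maximalIdeal R) :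
    ringKrullDim (R ⧸ p) ≤ l.length := by
  classical
  have : IsLocalRing (R ⧸ p) := .of_surjective' (Ideal.Quotient.mk p) Ideal.Quotient.mk_surjective
  rw [← IsLocalRing.maximalIdeal_height_eq_ringKrullDim]
  let s : Finset (R ⧸ p) := (l.map (Ideal.Quotient.mk p)).toFinset
  have hs : s.card ≤ l.length := (List.toFinset_card_le _).trans (by simp)
  have hcm : (IsLocalRing.maximalIdeal (R ⧸ p)).comap (Ideal.Quotient.mk p) =
      IsLocalRing.maximalIdeal R :=
    IsLocalRing.eq_maximalIdeal (Ideal.comap_isMaximal_of_surjective _ Ideal.Quotient.mk_surjective)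
  have hmin : IsLocalRing.maximalIdeal (R ⧸ p) ∈ (Ideal.span (s : Set (R ⧸ p))).minimalPrimes := by
    refine ⟨⟨inferInstance, Ideal.span_le.2 ?_⟩, ?_⟩
    · intro x hx
      simp only [s, List.coe_toFinset, List.mem_map, Set.mem_ofPred_eq] at hx
      obtain ⟨f, hf, rfl⟩ := hx
      have := hlm f hf
      rw [← hcm] at this
      exact this
    · rintro q ⟨hq, hsq⟩ _
      have := hl (q.comap (Ideal.Quotient.mk p)) inferInstance ?_ ?_
      · rw [← hcm] at this
        exact (Ideal.comap_injective_of_surjective _ Ideal.Quotient.mk_surjective this).ge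
      · intro r hr
        rw [Ideal.mem_comap, Ideal.Quotient.eq_zero_iff_mem.2 hr]
        exact zero_mem _
      · intro f hf
        exact hsq (Ideal.subset_span (by simp only [s, List.coe_toFinset, List.mem_map, Set.mem_ofPred_eq]; exact ⟨f, hf, rfl⟩))
  have := Ideal.height_le_card_of_mem_minimalPrimes_span_finset hmin
  have h2 : (IsLocalRing.maximalIdeal (R ⧸ p)).height ≤ (l.length : ℕ∞) :=
    this.trans (by exact_mod_cast hs)
  exact_mod_cast h2

/-- Regular sequence modulo `J`, recursively. -/
def SeqMod : Ideal R → List R → Prop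
  | _, [] => True
  | J, f :: l => RegMod J f ∧ SeqMod (J ⊔ Ideal.span {f}) l

theorem seqMod_of_depMod [IsNoetherianRing R] [IsLocalRing R] (l : List R) : ∀ (J : Ideal R)
    (_ : DepMod (IsLocalRing.maximalIdeal R) l.length J)
    (_ : ∀ f ∈ l, f ∈ IsLocalRing.maximalIdeal R)
    (_ : ∀ q : Ideal R, q.IsPrime → J ≤ q → (∀ f ∈ l, f ∈ q) → q = IsLocalRing.maximalIdeal R),
    SeqMod J l := by
  induction l with
  | nil => intros; trivial
  | cons f l ih =>
    intro J hd hlm hl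
    have hreg : RegMod J f := by
      by_contra hcon
      obtain ⟨p, hp, hfp⟩ := exists_assMod_of_not_reg hcon
      have h1 := depMod_le_dim _ _ _ hp hd
      have := hp.1
      have hJp : J ≤ p := by
        obtain ⟨_, z, hz⟩ := hp
        exact fun r hr => (hz r).2 (Ideal.mul_mem_right _ _ hr)
      have h2 := dim_le_length p l (fun q hq hpq hlq => hl q hq (hJp.trans hpq) (by
        intro g hg
        rcases List.mem_cons.1 hg with rfl | hg
        exacts [hpq hfp, hlq g hg])) (fun g hg => hlm g (List.mem_cons_of_mem _ hg))
      have h3 := h1.trans h2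
      rw [List.length_cons] at h3
      have : l.length + 1 ≤ l.length := by exact_mod_cast h3
      omega
    refine ⟨hreg, ih _ ?_ (fun g hg => hlm g (List.mem_cons_of_mem _ hg)) ?_⟩
    · obtain ⟨a, ham, ha, hd'⟩ := hd
      exact depMod_exchange inferInstance _ J a f ham (hlm f (by simp)) ha hreg hd'
    · intro q hq hJq hlq
      rw [sup_le_iff, Ideal.span_singleton_le_iff_mem] at hJq
      refine hl q hq hJq.1 fun g hg => ?_
      rcases List.mem_cons.1 hg with rfl | hg
      exacts [hJq.2, hlq g hg]
end

section
open MvPolynomial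
attribute [local instance] MvPolynomial.gradedAlgebra
variable {R : Type*} [CommRing R]

lemma SeqMod.depMod {m : Ideal R} (l : List R) : ∀ (J : Ideal R), SeqMod J l → (∀ f ∈ l, f ∈ m) →
    DepMod m l.length J := by
  induction l with
  | nil => intros; trivial
  | cons f l ih =>
    intro J h hl
    exact ⟨f, hl f (by simp), h.1, ih _ h.2 fun g hg => hl g (List.mem_cons_of_mem _ hg)⟩

lemma SeqMod.getElem (l : List R) : ∀ (J : Ideal R), SeqMod J l → ∀ i (h : i < l.length),
    RegMod (J ⊔ Ideal.ofList (l.take i)) l[i] := by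
  induction l with
  | nil => intro J _ i h; simp at h
  | cons f l ih =>
    intro J h i hi
    cases i with
    | zero => simpa using h.1
    | succ i =>
      have := ih _ h.2 i (by simpa using hi)
      simpa [sup_assoc] using this

lemma SeqMod.isWeaklyRegular {l : List R} (h : SeqMod ⊥ l) :
    RingTheory.Sequence.IsWeaklyRegular R l := by
  refine ⟨fun i hi => ?_⟩
  rw [isSMulRegular_quotient_iff_mem_of_smul_mem]
  have := SeqMod.getElem l ⊥ h i hi
  rw [bot_sup_eq] at this
  simpa [RegMod] using this

lemma regMod_map (m : Ideal R) [m.IsPrime] {J : Ideal R} {a : R} (h : RegMod J a) :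
    RegMod (J.map (algebraMap R (Localization.AtPrime m))) (algebraMap R _ a) := by
  intro x hx
  obtain ⟨y, s, rfl⟩ := IsLocalization.exists_mk'_eq m.primeCompl x
  rw [IsLocalization.mul_mk'_eq_mk'_of_mul,
    IsLocalization.mk'_mem_map_algebraMap_iff m.primeCompl] at hx
  obtain ⟨t, ht, htx⟩ := hx
  rw [IsLocalization.mk'_mem_map_algebraMap_iff m.primeCompl]
  exact ⟨t, ht, h _ (by rwa [mul_left_comm])⟩

lemma seqMod_map (m : Ideal R) [m.IsPrime] (l : List R) : ∀ (J : Ideal R), SeqMod J l →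
    SeqMod (J.map (algebraMap R (Localization.AtPrime m))) (l.map (algebraMap R _)) := by
  induction l with
  | nil => intros; trivial
  | cons f l ih =>
    intro J h
    refine ⟨regMod_map m h.1, ?_⟩
    have := ih _ h.2
    rwa [Ideal.map_sup, Ideal.map_span, Set.image_singleton] at this

lemma seqMod_X {σ : Type*} (l : List σ) : ∀ (s : Set σ), l.Nodup → (∀ i ∈ l, i ∉ s) →
    SeqMod (Ideal.span (X '' s : Set (MvPolynomial σ ℂ))) (l.map X) := by
  induction l with
  | nil => intros; trivial
  | cons i l ih =>
    intro s hl hs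
    rw [List.nodup_cons] at hl
    refine ⟨?_, ?_⟩
    · intro x hx
      rw [mem_ideal_span_X_image] at hx ⊢
      intro d hd
      obtain ⟨j, hj, hne⟩ := hx (Finsupp.single i 1 + d) (by
        rw [mem_support_iff, coeff_X_mul] ; exact mem_support_iff.1 hd)
      refine ⟨j, hj, ?_⟩
      have : i ≠ j := fun e => hs i (by simp) (e ▸ hj)
      simpa [Finsupp.single_apply, this] using hne
    · have := ih (insert i s) hl.2 (by
        rintro j hj (rfl | h)
        · exact hl.1 hj
        · exact hs j (List.mem_cons_of_mem _ hj) h)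
      rwa [Set.image_insert_eq, Ideal.span_insert, sup_comm] at this

lemma mem_of_mul_mem_of_homogeneous {σ : Type*} {J : Ideal (MvPolynomial σ ℂ)}
    (hJ : J.IsHomogeneous (homogeneousSubmodule σ ℂ)) {s g : MvPolynomial σ ℂ}
    (hs : constantCoeff s ≠ 0) (h : s * g ∈ J) : g ∈ J := by
  classical
  rw [hJ.mem_iff]
  intro n
  induction n using Nat.strong_induction_on with
  | _ n ih =>
    have h1 : (DirectSum.decompose (homogeneousSubmodule σ ℂ) (s * g) n : MvPolynomial σ ℂ) ∈ J :=
      (hJ.mem_iff).1 h n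
    have h2 : (DirectSum.decompose (homogeneousSubmodule σ ℂ) (s * g) n : MvPolynomial σ ℂ) =
        ∑ i ∈ Finset.range (s.totalDegree + 1), if i ≤ n then homogeneousComponent i s *
          (DirectSum.decompose (homogeneousSubmodule σ ℂ) g (n - i) : MvPolynomial σ ℂ) else 0 := by
      conv_lhs => rw [← sum_homogeneousComponent s, Finset.sum_mul, DirectSum.decompose_sum]
      rw [DFinsupp.finsetSum_apply, AddSubmonoidClass.coe_finsetSum]
      refine Finset.sum_congr rfl fun i _ => ?_
      exact DirectSum.coe_decompose_mul_of_left_mem _ n (homogeneousComponent_mem i s)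
    rw [h2, Finset.sum_range_succ'] at h1
    have h3 := (Submodule.add_mem_iff_right J (sum_mem fun i _ => ?_)).1 h1
    · simp only [zero_le, if_true, homogeneousComponent_zero, Nat.sub_zero] at h3
      have h4 := J.mul_mem_left (C (coeff 0 s)⁻¹) h3
      rwa [← mul_assoc, ← C_mul, inv_mul_cancel₀ (a := coeff 0 s) hs, C_1, one_mul] at h4
    · split_ifs with hi
      · exact J.mul_mem_left _ (ih _ (by omega))
      · exact zero_mem _

lemma seqMod_descend {σ : Type*} (m : Ideal (MvPolynomial σ ℂ)) [m.IsPrime]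
    (hm : ∀ s, s ∉ m → constantCoeff s ≠ 0) (l : List (MvPolynomial σ ℂ)) :
    ∀ (J : Ideal (MvPolynomial σ ℂ)), J.IsHomogeneous (homogeneousSubmodule σ ℂ) →
    (∀ f ∈ l, ∃ n, f.IsHomogeneous n) →
    SeqMod (J.map (algebraMap _ (Localization.AtPrime m))) (l.map (algebraMap _ _)) →
    SeqMod J l := by
  induction l with
  | nil => intros; trivial
  | cons f l ih =>
    intro J hJ hl h
    refine ⟨?_, ih _ ?_ (fun g hg => hl g (List.mem_cons_of_mem _ hg)) ?_⟩
    · intro x hx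
      have h1 := h.1 (algebraMap _ _ x) (by rw [← map_mul]; exact Ideal.mem_map_of_mem _ hx)
      rw [IsLocalization.algebraMap_mem_map_algebraMap_iff m.primeCompl] at h1
      obtain ⟨s, hs, hsx⟩ := h1
      exact mem_of_mul_mem_of_homogeneous hJ (hm s hs) hsx
    · refine hJ.sup (Ideal.homogeneous_span _ _ ?_)
      intro g hg
      rw [Set.mem_singleton_iff] at hg
      subst hg
      obtain ⟨n, hn⟩ := hl _ List.mem_cons_self
      exact ⟨n, hn⟩
    · have := h.2
      rwa [Ideal.map_sup, Ideal.map_span, Set.image_singleton]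

theorem homog_regular {n : ℕ} (l : List (MvPolynomial (Fin n) ℂ)) (hlen : l.length = n)
    (hh : ∀ f ∈ l, ∃ d, 1 ≤ d ∧ f.IsHomogeneous d)
    (hz : ∀ x : Fin n → ℂ, (∀ f ∈ l, eval x f = 0) → x = 0) :
    RingTheory.Sequence.IsRegular (MvPolynomial (Fin n) ℂ) l ∧
      FiniteDimensional ℂ (MvPolynomial (Fin n) ℂ ⧸ Ideal.ofList l) := by
  let m : Ideal (MvPolynomial (Fin n) ℂ) := RingHom.ker (constantCoeff (σ := Fin n) (R := ℂ))
  have hmax : m.IsMaximal := RingHom.ker_isMaximal_of_surjective _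
    (fun c => ⟨C c, constantCoeff_C _ c⟩)
  have hmX : ∀ i, X i ∈ m := fun i => by simp [m, RingHom.mem_ker]
  have hlm : ∀ f ∈ l, f ∈ m := by
    intro f hf
    obtain ⟨d, hd, hfd⟩ := hh f hf
    rw [RingHom.mem_ker, constantCoeff_eq]
    exact hfd.coeff_eq_zero (by simp; omega)
  have hrad : ∀ i, X i ∈ (Ideal.ofList l).radical := by
    intro i
    rw [← vanishingIdeal_zeroLocus_eq_radical (K := ℂ), zeroLocus_span]
    intro x hx
    have : x = 0 := hz x fun f hf => by simpa [aeval_eq_eval] using hx f hf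
    simp [this]
  have hmspan : m ≤ Ideal.span (Set.range X) := by
    intro f hf
    rw [← Set.image_univ, mem_ideal_span_X_image]
    intro d hd
    by_contra! hcon
    have : d = 0 := by ext i; simpa using hcon i (Set.mem_univ _)
    subst this
    exact mem_support_iff.1 hd hf
  have hmrad : m ≤ (Ideal.ofList l).radical :=
    hmspan.trans (Ideal.span_le.2 (by rintro _ ⟨i, rfl⟩; exact hrad i))
  have hbot : (⊥ : Ideal (MvPolynomial (Fin n) ℂ)) = Ideal.span (X '' ∅) := by simp
  refine ⟨⟨SeqMod.isWeaklyRegular ?_, ?_⟩, ?_⟩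
  · refine seqMod_descend m (fun s hs h => hs h) l ⊥ (Ideal.IsHomogeneous.bot
      (homogeneousSubmodule (Fin n) ℂ))
      (fun f hf => ⟨_, (hh f hf).choose_spec.2⟩) ?_
    have hmm : ∀ f ∈ m, algebraMap _ (Localization.AtPrime m) f ∈ IsLocalRing.maximalIdeal _ := by
      intro f hf
      rw [← Localization.AtPrime.map_eq_maximalIdeal]
      exact Ideal.mem_map_of_mem _ hf
    apply seqMod_of_depMod
    · have h1 := seqMod_X (σ := Fin n) (List.finRange n) ∅ (List.nodup_finRange n) (by simp)
      have h2 := seqMod_map m _ _ h1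
      have h3 := SeqMod.depMod (m := IsLocalRing.maximalIdeal (Localization.AtPrime m)) _ _ h2 (by
        simp only [List.mem_map]
        rintro _ ⟨_, ⟨i, _, rfl⟩, rfl⟩
        exact hmm _ (hmX i))
      rw [hbot]
      simpa [hlen] using h3
    · simp only [List.mem_map]
      rintro _ ⟨f, hf, rfl⟩
      exact hmm f (hlm f hf)
    · intro q hq _ hlq
      refine le_antisymm (IsLocalRing.le_maximalIdeal hq.ne_top) ?_
      rw [← Localization.AtPrime.map_eq_maximalIdeal, Ideal.map_le_iff_le_comap]
      have := hq.comap (algebraMap _ _) (R := MvPolynomial (Fin n) ℂ)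
      refine hmrad.trans (this.radical_le_iff.2 (Ideal.span_le.2 fun f hf => ?_))
      exact hlq _ (List.mem_map_of_mem hf)
  · intro h
    have h1 : Ideal.ofList l ≤ m := Ideal.span_le.2 fun f hf => hlm f hf
    have h2 : Ideal.ofList l = ⊤ := by simpa using h.symm
    exact hmax.ne_top (top_le_iff.1 (h2 ▸ h1))
  · have : Algebra.IsIntegral ℂ (MvPolynomial (Fin n) ℂ ⧸ Ideal.ofList l) := by
      constructor
      intro x
      obtain ⟨x, rfl⟩ := Ideal.Quotient.mk_surjective x
      induction x using MvPolynomial.induction_on with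
      | C a => exact isIntegral_algebraMap (R := ℂ) (x := a)
      | add p q hp hq => rw [map_add]; exact hp.add hq
      | mul_X p i hp =>
        rw [map_mul]
        refine hp.mul ?_
        obtain ⟨N, hN⟩ := hrad i
        refine IsIntegral.of_pow (n := N + 1) (by omega) ?_
        rw [← map_pow, Ideal.Quotient.eq_zero_iff_mem.2 (by rw [pow_succ]; exact Ideal.mul_mem_right _ _ hN)]
        exact isIntegral_zero
    exact Algebra.IsIntegral.finite
end

/-- let `F = Σ Pᵢ·Qᵢ` in `S = ℂ[x_0,…,x_{2k+1}]` with `Pᵢ` homogeneous of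
degree `dᵢ ≥ 1` and `Qᵢ` homogeneous of degree `e − dᵢ ≥ 1`. If the only common zero of
the partial derivatives of `F` is the origin, then `P₁,…,P_{k+1},Q₁,…,Q_{k+1}` is a
regular sequence; in particular `S/(P₁,…,P_{k+1},Q₁,…,Q_{k+1})` is a finite-dimensional
ℂ-vector space. -/
theorem statement12 (k : ℕ) (hk : 1 ≤ k)
    (P Q : Fin (k + 1) → MvPolynomial (Fin (2 * k + 2)) ℂ)
    (d : Fin (k + 1) → ℕ) (e : ℕ)
    (hd : ∀ i, 1 ≤ d i) (hde : ∀ i, 1 ≤ e - d i) (hdle : ∀ i, d i ≤ e)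
    (hP : ∀ i, (P i).IsHomogeneous (d i))
    (hQ : ∀ i, (Q i).IsHomogeneous (e - d i))
    (F : MvPolynomial (Fin (2 * k + 2)) ℂ) (hF : F = ∑ i, P i * Q i)
    (hsm : ∀ x : Fin (2 * k + 2) → ℂ,
      (∀ j, MvPolynomial.eval x (MvPolynomial.pderiv j F) = 0) → x = 0) :
    RingTheory.Sequence.IsRegular (MvPolynomial (Fin (2 * k + 2)) ℂ)
        (List.ofFn P ++ List.ofFn Q) ∧
      FiniteDimensional ℂ
        (MvPolynomial (Fin (2 * k + 2)) ℂ ⧸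
          Ideal.span (Set.range P ∪ Set.range Q)) := by
  have hz : ∀ x : Fin (2 * k + 2) → ℂ, (∀ f ∈ List.ofFn P ++ List.ofFn Q,
      MvPolynomial.eval x f = 0) → x = 0 := by
    intro x hx
    have hPx : ∀ i, MvPolynomial.eval x (P i) = 0 := fun i =>
      hx _ (List.mem_append_left _ (List.mem_ofFn.2 ⟨i, rfl⟩))
    have hQx : ∀ i, MvPolynomial.eval x (Q i) = 0 := fun i =>
      hx _ (List.mem_append_right _ (List.mem_ofFn.2 ⟨i, rfl⟩))
    refine hsm x fun j => ?_
    simp [hF, Derivation.leibniz, hPx, hQx]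
  have := homog_regular (List.ofFn P ++ List.ofFn Q) (by simp; omega) (by
    intro f hf
    simp only [List.mem_append, List.mem_ofFn] at hf
    rcases hf with ⟨i, rfl⟩ | ⟨i, rfl⟩
    exacts [⟨_, hd i, hP i⟩, ⟨_, hde i, hQ i⟩]) hz
  have e : Ideal.ofList (List.ofFn P ++ List.ofFn Q) = Ideal.span (Set.range P ∪ Set.range Q) := by
    rw [Ideal.ofList]
    congr 1
    ext f
    simp only [Set.mem_ofPred_eq, List.mem_append, List.mem_ofFn, Set.mem_union, Set.mem_range]
  rwa [e] at this
end

section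
/- Let k ≥ 1 and let S = ℂ[x_0,…,x_{2k+1}]. Let P_1, …, P_{k+1} be a regular sequence of homogeneous polynomials of degrees d_1, …, d_{k+1} ≥ 1, let Q_1, …, Q_{k+1} be homogeneous polynomials of degrees e − d_1, …, e − d_{k+1} ≥ 1, and set F = Σ_{j=1}^{k+1} P_j·Q_j. Suppose the only point x ∈ ℂ^{2k+2} at which all partial derivatives of F vanish is the origin. Then for each i ∈ {1,…,k+1}, the sequence P_1, …, P_{i−1}, Q_i, P_{i+1}, …, P_{k+1} is a regular sequence in S, and F lies in the ideal (P_1, …, P_{i−1}, Q_i, P_{i+1}, …, P_{k+1}). In other words, the hypersurface V(F) contains the residual complete intersection of multidegree (d_1,…,d_{i−1}, e−d_i, d_{i+1},…,d_{k+1}). -/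
open RingTheory.Sequence Pointwise in
lemma aux_cons {R : Type*} [CommRing R] (g : R) (rs : List R) :
    IsWeaklyRegular R (g :: rs) ↔ IsSMulRegular R g ∧
      IsWeaklyRegular (R ⧸ Ideal.span {g}) (rs.map (algebraMap R (R ⧸ Ideal.span {g}))) := by
  rw [isWeaklyRegular_cons_iff, isWeaklyRegular_map_algebraMap_iff]
  have h : (g • (⊤ : Submodule R R)) = Ideal.span {g} := by
    rw [← Submodule.ideal_span_singleton_smul]; simp
  exact and_congr Iff.rfl ((Submodule.quotEquivOfEq _ _ h).isWeaklyRegular_congr rs)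

lemma aux_nzd {R : Type*} [CommRing R] (I : Ideal R) (r : R) :
    IsSMulRegular (R ⧸ (I • ⊤ : Submodule R R)) r ↔ ∀ x, r * x ∈ I → x ∈ I := by
  rw [isSMulRegular_quotient_iff_mem_of_smul_mem]
  simp

open RingTheory.Sequence in
lemma aux_snoc {R : Type*} [CommRing R] (g : R) (rs : List R) :
    IsWeaklyRegular R (rs ++ [g]) ↔ IsWeaklyRegular R rs ∧
      ∀ x, g * x ∈ Ideal.ofList rs → x ∈ Ideal.ofList rs := by
  rw [isWeaklyRegular_append_iff, isWeaklyRegular_singleton_iff, aux_nzd]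

/-- prime avoidance in a coset -/
lemma aux_avoid {R : Type*} [CommRing R] [Algebra ℂ R] (a : R) (J : Ideal R)
    (s : Set (Ideal R)) (hs : s.Finite) (h : ∀ p ∈ s, ¬ (Ideal.span {a} ⊔ J ≤ p)) :
    ∃ t ∈ J, ∀ p ∈ s, a + t ∉ p := by
  classical
  let φ : (ℂ × (J.restrictScalars ℂ)) →ₗ[ℂ] R :=
    LinearMap.coprod (LinearMap.toSpanSingleton ℂ R a) (J.restrictScalars ℂ).subtype
  let s' : Finset (Subspace ℂ (ℂ × (J.restrictScalars ℂ))) :=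
    insert (LinearMap.ker (LinearMap.fst ℂ ℂ (J.restrictScalars ℂ)))
      (hs.toFinset.image fun p => (p.restrictScalars ℂ).comap φ)
  have htop : ⊤ ∉ s' := by
    intro ht
    rcases Finset.mem_insert.mp ht with ht | ht
    · have : ((1 : ℂ), (0 : J.restrictScalars ℂ)) ∈
        (⊤ : Subspace ℂ (ℂ × (J.restrictScalars ℂ))) := trivial
      rw [ht] at this
      simp at this
    · obtain ⟨p, hp, hpt⟩ := Finset.mem_image.mp ht
      apply h p (by simpa using hp)
      have key : ∀ x, φ x ∈ p := fun x => by
        have : x ∈ (p.restrictScalars ℂ).comap φ := by rw [hpt]; trivial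
        simpa using this
      refine sup_le ?_ ?_
      · rw [Ideal.span_singleton_le_iff_mem]
        simpa [φ] using key (1, 0)
      · intro t ht
        simpa [φ] using key (0, ⟨t, ht⟩)
  have := Subspace.biUnion_ne_univ_of_top_notMem htop
  rw [Set.ne_univ_iff_exists_notMem] at this
  obtain ⟨⟨c, t, ht⟩, hx⟩ := this
  simp only [Set.mem_iUnion, not_exists] at hx
  have hc : c ≠ 0 := by
    have := hx _ (Finset.mem_insert_self _ _)
    simpa using this
  have ht' : t ∈ J := ht
  refine ⟨algebraMap ℂ R c⁻¹ * t, J.mul_mem_left _ ht', fun p hp hmem => ?_⟩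
  apply hx ((p.restrictScalars ℂ).comap φ)
    (Finset.mem_insert_of_mem (Finset.mem_image.mpr ⟨p, by simpa using hp, rfl⟩))
  have h2 := p.mul_mem_left (algebraMap ℂ R c) hmem
  have h3 : algebraMap ℂ R c * (a + algebraMap ℂ R c⁻¹ * t) = φ (c, ⟨t, ht⟩) := by
    rw [mul_add, ← mul_assoc, ← map_mul, mul_inv_cancel₀ hc]
    simp [φ, Algebra.smul_def]
  rw [h3] at h2
  exact h2

open RingTheory.Sequence IsLocalRing in
theorem aux_local (n : ℕ) : ∀ (R : Type) [CommRing R] [IsLocalRing R] [IsNoetherianRing R]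
    [Algebra ℂ R] (a f : List R), a.length = n → f.length = n →
    (∀ r ∈ a, r ∈ maximalIdeal R) → (∀ r ∈ f, r ∈ maximalIdeal R) →
    IsWeaklyRegular R a →
    (∀ q : Ideal R, q.IsPrime → Ideal.ofList a ≤ q → q = maximalIdeal R) →
    (∀ q : Ideal R, q.IsPrime → Ideal.ofList f ≤ q → q = maximalIdeal R) →
    IsWeaklyRegular R f := by
  induction n with
  | zero =>
    intro R _ _ _ _ a f _ hf _ _ _ _ _
    rw [List.length_eq_zero_iff.mp hf]
    exact IsWeaklyRegular.nil _ _
  | succ n ih =>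
    intro R _ _ _ _ a f hal hfl ham hfm hareg haq hfq
    obtain ⟨a1, as, rfl⟩ := List.exists_cons_of_length_eq_add_one hal
    obtain rfl | ⟨fs, fN, rfl⟩ := List.eq_nil_or_concat' f
    · simp at hfl
    simp only [List.length_append, List.length_cons, List.length_nil, zero_add,
      Nat.add_right_cancel_iff] at hfl hal
    -- the maximal ideal is not minimal over `fs`
    have hmin : maximalIdeal R ∉ (Ideal.ofList fs).minimalPrimes := by
      intro hm
      have h1 : (maximalIdeal R).height ≤ {r | r ∈ fs}.ncard :=
        Ideal.height_le_card_of_mem_minimalPrimes_span (List.finite_toSet fs) hm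
      have h2 : {r | r ∈ fs}.ncard ≤ n := by
        classical
        have : {r | r ∈ fs} = (fs.toFinset : Set R) := by ext; simp
        rw [this, Set.ncard_coe_finset, ← hfl]
        exact List.toFinset_card_le fs
      have hr : IsRegular R (a1 :: as) := .of_isWeaklyRegular_of_mem_maximalIdeal R ham hareg
      have h3 := ringKrullDim_add_length_eq_ringKrullDim_of_isRegular _ hr
      rw [← maximalIdeal_height_eq_ringKrullDim (R := R), List.length_cons, hal] at h3
      have : Nontrivial (R ⧸ Ideal.ofList (a1 :: as)) := by
        apply Ideal.Quotient.nontrivial_iff.mpr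
        intro h
        have := Ideal.span_le.mpr ham
        change Ideal.ofList (a1 :: as) ≤ _ at this
        rw [h] at this
        exact Ideal.IsPrime.ne_top' (top_le_iff.mp this)
      have h4 : (0 : WithBot ℕ∞) ≤ ringKrullDim (R ⧸ Ideal.ofList (a1 :: as)) :=
        ringKrullDim_nonneg_of_nontrivial
      have h5 : (maximalIdeal R).height ≤ n := h1.trans (by exact_mod_cast h2)
      have h6 : ((n + 1 : ℕ) : WithBot ℕ∞) ≤ (maximalIdeal R).height := by
        rw [← h3]
        exact le_add_of_nonneg_left h4
      have h7 : ((n + 1 : ℕ) : WithBot ℕ∞) ≤ ((n : ℕ∞) : WithBot ℕ∞) :=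
        h6.trans (WithBot.coe_le_coe.mpr h5)
      have h8 : n + 1 ≤ n := by exact_mod_cast h7
      omega
    obtain ⟨t, ht, hg⟩ := aux_avoid a1 (Ideal.ofList as) (Ideal.ofList fs).minimalPrimes
      (Ideal.finite_minimalPrimes_of_isNoetherianRing R _) (fun p hp hle => by
        rw [← Ideal.ofList_cons] at hle
        exact hmin (haq p hp.1.1 hle ▸ hp))
    have hasm : Ideal.ofList as ≤ maximalIdeal R :=
      Ideal.span_le.mpr fun r hr => ham r (List.mem_cons_of_mem _ hr)
    set g := a1 + t with hgdef
    have hgm : g ∈ maximalIdeal R := add_mem (ham _ List.mem_cons_self) (hasm ht)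
    have hgas : IsWeaklyRegular R (g :: as) := by
      have h1 : IsWeaklyRegular R (as ++ [a1]) :=
        isWeaklyRegular_of_perm_of_subset_maximalIdeal hareg
          (List.perm_append_singleton a1 as).symm ham
      rw [aux_snoc] at h1
      have h2 : IsWeaklyRegular R (as ++ [g]) := by
        rw [aux_snoc]
        refine ⟨h1.1, fun x hx => h1.2 x ?_⟩
        have : a1 * x = g * x - t * x := by rw [hgdef]; ring
        rw [this]
        exact sub_mem hx (Ideal.mul_mem_right _ _ ht)
      refine isWeaklyRegular_of_perm_of_subset_maximalIdeal h2
          (List.perm_append_singleton g as) ?_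
      intro r hr
      rcases List.mem_append.mp hr with hr | hr
      · exact ham r (List.mem_cons_of_mem _ hr)
      · rw [List.mem_singleton.mp hr]; exact hgm
    have hgq : ∀ q : Ideal R, q.IsPrime → g ∈ q → Ideal.ofList as ≤ q → q = maximalIdeal R := by
      intro q hq hgq hle
      refine haq q hq ?_
      rw [Ideal.ofList_cons, sup_le_iff, Ideal.span_singleton_le_iff_mem]
      refine ⟨?_, hle⟩
      have : a1 = g - t := by rw [hgdef]; ring
      rw [this]
      exact sub_mem hgq (hle ht)
    have hfsq : ∀ q : Ideal R, q.IsPrime → g ∈ q → Ideal.ofList fs ≤ q → q = maximalIdeal R := by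
      intro q hq hgq hle
      by_contra hne
      have hlt : q < maximalIdeal R := lt_of_le_of_ne (le_maximalIdeal hq.ne_top) hne
      refine hg q ?_ hgq
      refine Ideal.mem_minimalPrimes_span_of_mem_minimalPrimes_span_insert hlt fN {r | r ∈ fs} ?_ 
        {r | r ∈ fs} (fun r hr => hle (Ideal.subset_span hr)) 
        (fun r hr => Ideal.le_radical (Ideal.subset_span (Set.mem_insert_of_mem _ hr)))
      refine ⟨⟨inferInstance, ?_⟩, ?_⟩
      · rw [Ideal.span_le]
        rintro r (rfl | hr)
        · exact hfm _ (by simp)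
        · exact hfm _ (List.mem_append_left _ hr)
      · rintro q' ⟨hq', hle'⟩ _
        refine (hfq q' hq' ?_).ge
        refine le_trans (Ideal.span_mono ?_) hle'
        intro r hr
        rcases List.mem_append.mp hr with hr | hr
        · exact Set.mem_insert_of_mem _ hr
        · rw [List.mem_singleton.mp hr]; exact Set.mem_insert _ _
    have hne : Ideal.span {g} ≠ ⊤ := fun h => by
      have := (Ideal.span_singleton_le_iff_mem _).mpr hgm
      rw [h] at this
      exact Ideal.IsPrime.ne_top' (top_le_iff.mp this)
    have : Nontrivial (R ⧸ Ideal.span {g}) := Ideal.Quotient.nontrivial_iff.mpr hne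
    have : IsLocalRing (R ⧸ Ideal.span {g}) :=
      .of_surjective' _ (Ideal.Quotient.mk_surjective (I := Ideal.span {g}))
    have hsurj : Function.Surjective (algebraMap R (R ⧸ Ideal.span {g})) :=
      Ideal.Quotient.mk_surjective
    have hcomap : (maximalIdeal (R ⧸ Ideal.span {g})).comap (algebraMap R _) = maximalIdeal R := by
      have : IsLocalHom (algebraMap R (R ⧸ Ideal.span {g})) := .of_surjective _ hsurj
      exact ((local_hom_TFAE (algebraMap R (R ⧸ Ideal.span {g}))).out 0 4).mp this
    have hmem : ∀ l : List R, (∀ r ∈ l, r ∈ maximalIdeal R) →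
        ∀ r ∈ l.map (algebraMap R (R ⧸ Ideal.span {g})), r ∈ maximalIdeal _ := by
      intro l hl r hr
      obtain ⟨r', hr', rfl⟩ := List.mem_map.mp hr
      rw [← Ideal.mem_comap, hcomap]
      exact hl r' hr'
    have hprim : ∀ l : List R, (∀ q : Ideal R, q.IsPrime → g ∈ q → Ideal.ofList l ≤ q →
        q = maximalIdeal R) → ∀ q : Ideal (R ⧸ Ideal.span {g}), q.IsPrime →
        Ideal.ofList (l.map (algebraMap R (R ⧸ Ideal.span {g}))) ≤ q → q = maximalIdeal _ := by
      intro l hl q hq hle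
      apply Ideal.comap_injective_of_surjective _ hsurj
      rw [hcomap]
      apply hl _ (Ideal.comap_isPrime _ _)
      · rw [Ideal.mem_comap]
        have : algebraMap R (R ⧸ Ideal.span {g}) g = 0 :=
          Ideal.Quotient.eq_zero_iff_mem.mpr (Ideal.mem_span_singleton_self g)
        rw [this]; exact zero_mem _
      · rw [← Ideal.map_le_iff_le_comap, Ideal.map_ofList]
        exact hle
    have hfsm : ∀ r ∈ fs, r ∈ maximalIdeal R := fun r hr => hfm r (List.mem_append_left _ hr)
    have hfsreg := ih (R ⧸ Ideal.span {g}) (as.map (algebraMap R _)) (fs.map (algebraMap R _))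
      (by simpa using hal) (by simpa using hfl)
      (hmem as fun r hr => ham r (List.mem_cons_of_mem _ hr)) (hmem fs hfsm)
      ((aux_cons g as).mp hgas).2 (hprim as hgq) (hprim fs hfsq)
    have h1 : IsWeaklyRegular R (g :: fs) :=
      (aux_cons g fs).mpr ⟨((aux_cons g as).mp hgas).1, hfsreg⟩
    have h2 : IsWeaklyRegular R (fs ++ [g]) :=
      isWeaklyRegular_of_perm_of_subset_maximalIdeal h1
        (List.perm_append_singleton g fs).symm (by
          intro r hr
          rcases List.mem_cons.mp hr with rfl | hr
          · exact hgm
          · exact hfsm r hr)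
    rw [aux_snoc] at h2 ⊢
    refine ⟨h2.1, fun x hx => ?_⟩
    have hrad : g ∈ (Ideal.ofList (fs ++ [fN])).radical := by
      rw [Ideal.radical_eq_sInf, Ideal.mem_sInf]
      rintro q ⟨hle, hq⟩
      rw [hfq q hq hle]; exact hgm
    obtain ⟨m, hm⟩ := hrad
    rw [Ideal.ofList_append, Ideal.ofList_singleton] at hm
    obtain ⟨y, hy, z, hz, hyz⟩ := Submodule.mem_sup.mp hm
    obtain ⟨w, rfl⟩ := Ideal.mem_span_singleton'.mp hz
    have h3 : g ^ m * x ∈ Ideal.ofList fs := by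
      rw [← hyz]
      have : (y + w * fN) * x = y * x + w * (fN * x) := by ring
      rw [this]
      exact add_mem (Ideal.mul_mem_right _ _ hy) (Ideal.mul_mem_left _ _ hx)
    clear hm hyz
    induction m with
    | zero => simpa using h3
    | succ m ihm =>
      apply ihm
      apply h2.2
      rw [← mul_assoc, ← pow_succ']
      exact h3

open MvPolynomial in
lemma aux_descent {σ : Type*} (I : Ideal (MvPolynomial σ ℂ))
    (hI : ∀ x ∈ I, ∀ d, homogeneousComponent d x ∈ I)
    (s a : MvPolynomial σ ℂ) (hs : coeff 0 s ≠ 0) (h : s * a ∈ I) : a ∈ I := by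
  have key : ∀ d, homogeneousComponent d a ∈ I := by
    intro d
    induction d using Nat.strong_induction_on with
    | _ d ih =>
    have h1 := hI _ h d
    have h2 : homogeneousComponent d (s * a) =
        ∑ x ∈ Finset.range (s.totalDegree + 1) ×ˢ Finset.range (a.totalDegree + 1 + d),
          if x.1 + x.2 = d then homogeneousComponent x.1 s * homogeneousComponent x.2 a else 0 := by
      have ha : ∑ j ∈ Finset.range (a.totalDegree + 1 + d), homogeneousComponent j a = a := by
        rw [← Finset.sum_subset (Finset.range_subset_range.mpr
          (Nat.le_add_right (a.totalDegree + 1) d)), sum_homogeneousComponent]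
        intro x _ hx
        apply homogeneousComponent_eq_zero
        simp at hx; omega
      conv_lhs => rw [← sum_homogeneousComponent s, ← ha, Finset.sum_mul_sum, ← Finset.sum_product']
      rw [map_sum]
      refine Finset.sum_congr rfl fun x _ => ?_
      rw [homogeneousComponent_of_mem (n := x.1 + x.2)]
      · simp only [eq_comm]
      · exact (homogeneousComponent_isHomogeneous _ _).mul (homogeneousComponent_isHomogeneous _ _)
    rw [h2, ← Finset.add_sum_erase _ _ (a := (0, d)) (by simp)] at h1
    rw [Submodule.add_mem_iff_left] at h1
    · simp only [zero_add, if_true, homogeneousComponent_zero] at h1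
      have := I.mul_mem_left (C (coeff 0 s)⁻¹) h1
      rwa [← mul_assoc, ← C_mul, inv_mul_cancel₀ hs, C_1, one_mul] at this
    · refine I.sum_mem fun x hx => ?_
      obtain ⟨i, j⟩ := x
      split_ifs with hij
      · simp only at hij
        apply I.mul_mem_left
        apply ih
        simp only [Finset.mem_erase, ne_eq, Prod.mk.injEq] at hx
        have := hx.1
        by_contra hj
        exact this ⟨by omega, by omega⟩
      · exact zero_mem _
  rw [← sum_homogeneousComponent a]
  exact I.sum_mem fun i _ => key i

open MvPolynomial RingTheory.Sequence in
lemma aux_X (n : ℕ) : IsWeaklyRegular (MvPolynomial (Fin n) ℂ)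
    (List.ofFn (X : Fin n → MvPolynomial (Fin n) ℂ)) := by
  constructor
  intro i hi
  rw [isSMulRegular_quotient_iff_mem_of_smul_mem]
  have hi' : i < n := by simpa using hi
  have hset : {r | r ∈ (List.ofFn (X : Fin n → MvPolynomial (Fin n) ℂ)).take i} =
      X '' {j : Fin n | j.1 < i} := by
    ext r
    simp only [Set.mem_ofPred_eq, List.mem_take_iff_getElem, Set.mem_image]
    constructor
    · rintro ⟨j, hj, rfl⟩
      simp at hj
      exact ⟨⟨j, hj.2⟩, hj.1, by simp⟩
    · rintro ⟨j, hj, rfl⟩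
      exact ⟨j, by simp [hj], by simp⟩
  simp only [Ideal.ofList, hset, List.getElem_ofFn, smul_eq_mul, Ideal.mul_top, mem_ideal_span_X_image]
  intro x hx m hm
  obtain ⟨j, hj, hne⟩ := hx (m + Finsupp.single ⟨i, hi'⟩ 1) (by
    rw [mul_comm, mem_support_iff, coeff_mul_X]
    exact mem_support_iff.mp hm)
  refine ⟨j, hj, ?_⟩
  have : (⟨i, hi'⟩ : Fin n) ≠ j := by
    rintro rfl; simp at hj
  simpa [Finsupp.single_apply, this] using hne

open MvPolynomial in
lemma aux_homog {σ : Type*} (l : List (MvPolynomial σ ℂ))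
    (hl : ∀ f ∈ l, ∃ d, f.IsHomogeneous d) :
    ∀ x ∈ Ideal.ofList l, ∀ d, homogeneousComponent d x ∈ Ideal.ofList l := by
  letI : GradedAlgebra (homogeneousSubmodule σ ℂ) := MvPolynomial.gradedAlgebra
  have h : (Ideal.ofList l).IsHomogeneous (homogeneousSubmodule σ ℂ) :=
    Ideal.homogeneous_span _ _ fun f hf => hl f hf
  intro x hx d
  exact homogeneousComponent_mem_of_mem h hx d

open MvPolynomial RingTheory.Sequence IsLocalRing in
theorem aux_graded (n : ℕ) (f : List (MvPolynomial (Fin n) ℂ)) (hn : f.length = n)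
    (hh : ∀ p ∈ f, ∃ d, 1 ≤ d ∧ p.IsHomogeneous d)
    (hV : ∀ x : Fin n → ℂ, (∀ p ∈ f, eval x p = 0) → x = 0) :
    IsWeaklyRegular (MvPolynomial (Fin n) ℂ) f := by
  let M : Ideal (MvPolynomial (Fin n) ℂ) := vanishingIdeal ℂ {(0 : Fin n → ℂ)}
  have hMmem : ∀ p, p ∈ M ↔ coeff 0 p = 0 := by
    intro p
    rw [mem_vanishingIdeal_singleton_iff, aeval_eq_eval, ← constantCoeff_eq]
    simp
  have hfM : ∀ p ∈ f, p ∈ M := by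
    intro p hp
    obtain ⟨d, hd, hpd⟩ := hh p hp
    rw [hMmem]
    apply hpd.coeff_eq_zero
    simp; omega
  let R := Localization.AtPrime M
  have hcomapM : (maximalIdeal R).comap (algebraMap _ R) = M :=
    IsLocalization.AtPrime.under_maximalIdeal R M
  have hmem : ∀ l : List (MvPolynomial (Fin n) ℂ), (∀ p ∈ l, p ∈ M) →
      ∀ r ∈ l.map (algebraMap _ R), r ∈ maximalIdeal R := by
    intro l hl r hr
    obtain ⟨p, hp, rfl⟩ := List.mem_map.mp hr
    rw [← Ideal.mem_comap, hcomapM]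
    exact hl p hp
  have hprim : ∀ l : List (MvPolynomial (Fin n) ℂ), 
      (∀ x : Fin n → ℂ, (∀ p ∈ l, eval x p = 0) → x = 0) →
      ∀ q : Ideal R, q.IsPrime → Ideal.ofList (l.map (algebraMap _ R)) ≤ q →
      q = maximalIdeal R := by
    intro l hl q hq hle
    refine le_antisymm (le_maximalIdeal hq.ne_top) ?_
    have h0 := IsLocalization.map_under M.primeCompl R (maximalIdeal R)
    change Ideal.map _ (Ideal.comap _ _) = _ at h0
    rw [← h0, hcomapM, Ideal.map_le_iff_le_comap]
    have h1 : Ideal.ofList l ≤ q.comap (algebraMap _ R) := by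
      rw [← Ideal.map_le_iff_le_comap, Ideal.map_ofList]; exact hle
    have h2 : M ≤ (Ideal.ofList l).radical := by
      rw [← vanishingIdeal_zeroLocus_eq_radical (K := ℂ)]
      apply vanishingIdeal_anti_mono
      intro x hx
      apply hl x
      intro p hp
      have := hx p (Ideal.subset_span hp)
      rwa [aeval_eq_eval] at this
    have hq' : (q.comap (algebraMap (MvPolynomial (Fin n) ℂ) R)).IsPrime := Ideal.comap_isPrime _ _
    exact h2.trans (hq'.radical_le_iff.mpr h1)
  have hreg : IsWeaklyRegular R (f.map (algebraMap _ R)) := by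
    apply aux_local n R ((List.ofFn (X : Fin n → MvPolynomial (Fin n) ℂ)).map (algebraMap _ R))
    · simp
    · simpa using hn
    · apply hmem
      intro p hp
      obtain ⟨i, rfl⟩ := List.mem_ofFn.mp hp
      rw [hMmem]; simp
    · exact hmem f hfM
    · exact (aux_X n).of_isLocalization R M.primeCompl
    · apply hprim
      intro x hx
      ext i
      simpa using hx (X i) (List.mem_ofFn.mpr ⟨i, rfl⟩)
    · exact hprim f hV
  constructor
  intro i hi
  have h1 := hreg.regular_mod_prev i (by simpa using hi)
  rw [isSMulRegular_quotient_iff_mem_of_smul_mem] at h1 ⊢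
  intro x hx
  simp only [smul_eq_mul, Ideal.mul_top] at h1 hx ⊢
  have h2 := h1 (algebraMap _ R x) (by
    rw [← List.map_take, ← Ideal.map_ofList, List.getElem_map, ← map_mul]
    exact Ideal.mem_map_of_mem _ hx)
  rw [← List.map_take, ← Ideal.map_ofList,
    IsLocalization.algebraMap_mem_map_algebraMap_iff M.primeCompl] at h2
  obtain ⟨s, hs, hsx⟩ := h2
  refine aux_descent _ (aux_homog _ fun p hp => ?_) s x (fun h => hs ((hMmem s).mpr h)) hsx
  obtain ⟨d, _, hd⟩ := hh p (List.mem_of_mem_take hp)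
  exact ⟨d, hd⟩

/-- let `P₁,…,P_{k+1}` be a regular sequence of homogeneous polynomials of
degrees `dᵢ ≥ 1` in `S = ℂ[x_0,…,x_{2k+1}]`, let `Qᵢ` be homogeneous of degree
`e − dᵢ ≥ 1`, and `F = Σ Pⱼ·Qⱼ`. If the only common zero of the partial derivatives of
`F` is the origin, then for each `i` the sequence `P₁,…,P_{i−1},Qᵢ,P_{i+1},…,P_{k+1}`
is a regular sequence and `F ∈ (P₁,…,P_{i−1},Qᵢ,P_{i+1},…,P_{k+1})`: the hypersurface
`V(F)` contains the residual complete intersection of multidegree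
`(d₁,…,d_{i−1}, e−dᵢ, d_{i+1},…,d_{k+1})`. -/
theorem statement13 (k : ℕ) (hk : 1 ≤ k)
    (P Q : Fin (k + 1) → MvPolynomial (Fin (2 * k + 2)) ℂ)
    (d : Fin (k + 1) → ℕ) (e : ℕ)
    (hd : ∀ i, 1 ≤ d i) (hde : ∀ i, 1 ≤ e - d i) (hdle : ∀ i, d i ≤ e)
    (hP : ∀ i, (P i).IsHomogeneous (d i))
    (hQ : ∀ i, (Q i).IsHomogeneous (e - d i))
    (hPreg : RingTheory.Sequence.IsRegular (MvPolynomial (Fin (2 * k + 2)) ℂ)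
      (List.ofFn P))
    (F : MvPolynomial (Fin (2 * k + 2)) ℂ) (hF : F = ∑ j, P j * Q j)
    (hsm : ∀ x : Fin (2 * k + 2) → ℂ,
      (∀ j, MvPolynomial.eval x (MvPolynomial.pderiv j F) = 0) → x = 0) :
    ∀ i : Fin (k + 1),
      RingTheory.Sequence.IsRegular (MvPolynomial (Fin (2 * k + 2)) ℂ)
          (List.ofFn (Function.update P i (Q i))) ∧
        F ∈ Ideal.span (Set.range (Function.update P i (Q i))) := by
  intro i
  have hu : ∀ p ∈ List.ofFn (Function.update P i (Q i)),
      ∃ d, 1 ≤ d ∧ p.IsHomogeneous d := by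
    intro p hp
    obtain ⟨j, rfl⟩ := List.mem_ofFn.mp hp
    by_cases hj : j = i
    · subst hj; simpa using ⟨_, hde j, hQ j⟩
    · simpa [hj] using ⟨_, hd j, hP j⟩
  have hv : ∀ p ∈ List.ofFn (Function.update Q i (P i)),
      ∃ d, 1 ≤ d ∧ p.IsHomogeneous d := by
    intro p hp
    obtain ⟨j, rfl⟩ := List.mem_ofFn.mp hp
    by_cases hj : j = i
    · subst hj; simpa using ⟨_, hd j, hP j⟩
    · simpa [hj] using ⟨_, hde j, hQ j⟩
  refine ⟨⟨?_, ?_⟩, ?_⟩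
  · have := aux_graded (2 * k + 2)
      (List.ofFn (Function.update P i (Q i)) ++ List.ofFn (Function.update Q i (P i)))
      (by simp; omega)
      (by
        intro p hp
        rcases List.mem_append.mp hp with hp | hp
        · exact hu p hp
        · exact hv p hp)
      (by
        intro x hx
        have hPQ : ∀ j, MvPolynomial.eval x (P j) = 0 ∧ MvPolynomial.eval x (Q j) = 0 := by
          intro j
          have h1 := hx _ (List.mem_append_left _ (List.mem_ofFn.mpr ⟨j, rfl⟩))
          have h2 := hx _ (List.mem_append_right _ (List.mem_ofFn.mpr ⟨j, rfl⟩))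
          by_cases hj : j = i
          · subst hj
            simp only [Function.update_self] at h1 h2
            exact ⟨h2, h1⟩
          · simp only [Function.update_of_ne hj] at h1 h2
            exact ⟨h1, h2⟩
        apply hsm
        intro j
        rw [hF, map_sum, map_sum]
        refine Finset.sum_eq_zero fun l _ => ?_
        simp [Derivation.leibniz, (hPQ l).1, (hPQ l).2])
    exact ((RingTheory.Sequence.isWeaklyRegular_append_iff _ _ _).mp this).1
  · intro h
    have h1 : (1 : MvPolynomial (Fin (2 * k + 2)) ℂ) ∈
        Ideal.ofList (List.ofFn (Function.update P i (Q i))) := by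
      have : (1 : MvPolynomial (Fin (2 * k + 2)) ℂ) ∈
        (⊤ : Submodule (MvPolynomial (Fin (2 * k + 2)) ℂ) (MvPolynomial (Fin (2 * k + 2)) ℂ)) :=
          trivial
      rw [h] at this
      simpa using this
    have h2 : Ideal.ofList (List.ofFn (Function.update P i (Q i))) ≤
        RingHom.ker (MvPolynomial.constantCoeff (σ := Fin (2 * k + 2)) (R := ℂ)) := by
      rw [Ideal.span_le]
      intro p hp
      obtain ⟨d, hd, hpd⟩ := hu p hp
      simp only [SetLike.mem_coe, RingHom.mem_ker, MvPolynomial.constantCoeff_eq]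
      apply hpd.coeff_eq_zero
      simp; omega
    have := h2 h1
    simp [RingHom.mem_ker] at this
  · rw [hF]
    refine Ideal.sum_mem _ fun j _ => ?_
    have hj := Ideal.subset_span (Set.mem_range_self (f := Function.update P i (Q i)) j)
    by_cases h : j = i
    · subst h
      rw [Function.update_self] at hj
      exact Ideal.mul_mem_left _ _ hj
    · rw [Function.update_of_ne h] at hj
      exact Ideal.mul_mem_right _ _ hj
end
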